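/- arXiv:1106.2058 — 2 statements merged into one kernel-verified Lean document; each statement's English description precedes it below -/
import Mathlib

section
/- Let Ψ^n be the Pólya urn configuration with n colors, 2m(n) balls and parameter κ, where 2m(n)/n² → ρ ∈ (0,∞). Then for every k and all ν_1,...,ν_k ∈ ℕ: lim_{n→∞} E[∏_{i=1}^k ((1/n)·d(Ψ^n, i))^{ν_i}] = ∏_{i=1}^k (ρ/κ)^{ν_i} · ∏_{j=1}^{ν_i} (κ + j − 1). Consequently ((1/n)d(Ψ^n,i))_{i=1}^k converges in distribution to k i.i.d. Gamma(κ, κ/ρ) random variables. -/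
open Finset Nat MeasureTheory ProbabilityTheory Filter

/-- The number of balls of color `i` (as a natural number) in the urn configuration. -/
def colorCountNat {M n : ℕ} (ψ : Fin M → Fin n) (i : ℕ) : ℕ :=
  (Finset.univ.filter fun l => (ψ l : ℕ) = i).card

/-- The closed-form Pólya urn probability. -/
noncomputable def polyaProb (κ : ℝ) {M n : ℕ} (ψ : Fin M → Fin n) : ℝ :=
  (∏ i : Fin n, ∏ j ∈ Finset.range (colorCountNat ψ i), (κ + j)) /
    ∏ j ∈ Finset.range M, (κ * n + j)

section PolyaUrn

lemma colorCountNat_cons {M n : ℕ} (c : Fin n) (ψ : Fin M → Fin n) (i : ℕ) :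
    colorCountNat (Fin.cons c ψ : Fin (M + 1) → Fin n) i =
      (if (c : ℕ) = i then 1 else 0) + colorCountNat ψ i := by
  simp only [colorCountNat, Finset.card_filter, Fin.sum_univ_succ, Fin.cons_zero, Fin.cons_succ]

lemma sum_colorCountNat {M n : ℕ} (ψ : Fin M → Fin n) :
    ∑ i : Fin n, colorCountNat ψ i = M := by
  simp only [colorCountNat, Finset.card_filter]
  rw [Finset.sum_comm]
  simp [Fin.val_inj]

/-- The weights of a Pólya urn with initial masses `a i` sum to a rising factorial. -/
lemma sum_prod_rising {n : ℕ} (a : Fin n → ℝ) (M : ℕ) :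
    ∑ ψ : Fin M → Fin n, ∏ i : Fin n, ∏ j ∈ Finset.range (colorCountNat ψ i), (a i + j) =
      ∏ j ∈ Finset.range M, (∑ i, a i + j) := by
  induction M with
  | zero => simp [colorCountNat]
  | succ M ih =>
    rw [Finset.prod_range_succ, ← ih, ← (Fin.consEquiv fun _ : Fin (M + 1) => Fin n).sum_comp,
      Fintype.sum_prod_type_right, Finset.sum_mul]
    refine Finset.sum_congr rfl fun ψ _ => ?_
    have hstep (c : Fin n) :
        ∏ i : Fin n, ∏ j ∈ Finset.range
            (colorCountNat (Fin.cons c ψ : Fin (M + 1) → Fin n) i), (a i + j) =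
          (∏ i : Fin n, ∏ j ∈ Finset.range (colorCountNat ψ i), (a i + j)) *
            (a c + colorCountNat ψ c) := by
      rw [← Finset.mul_prod_erase _ _ (Finset.mem_univ c),
        ← Finset.mul_prod_erase _ (fun i : Fin n => ∏ j ∈ Finset.range (colorCountNat ψ i), _)
          (Finset.mem_univ c), colorCountNat_cons, if_pos rfl, add_comm 1, Finset.prod_range_succ,
        mul_right_comm]
      congr 2
      refine Finset.prod_congr rfl fun i hi => ?_
      rw [colorCountNat_cons, if_neg, zero_add]
      rw [Fin.val_inj]
      exact (Finset.ne_of_mem_erase hi).symm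
    simp only [Fin.consEquiv, Equiv.coe_fn_mk, hstep]
    rw [← Finset.mul_sum, Finset.sum_add_distrib, ← Nat.cast_sum, sum_colorCountNat]

lemma prod_rising_mul_prod_rising (κ : ℝ) (d ν : ℕ) :
    (∏ j ∈ Finset.range d, (κ + j)) * ∏ j ∈ Finset.range ν, (κ + d + j) =
      (∏ j ∈ Finset.range ν, (κ + j)) * ∏ j ∈ Finset.range d, (κ + ν + j) := by
  have h (x y : ℕ) : (∏ j ∈ Finset.range x, (κ + j)) * ∏ j ∈ Finset.range y, (κ + x + j) =
      ∏ j ∈ Finset.range (x + y), (κ + j) := by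
    rw [Finset.prod_range_add]
    congr 1
    refine Finset.prod_congr rfl fun j _ => ?_
    push_cast
    ring
  rw [h, h, add_comm]

lemma prod_fin_eq_prod_fin_of_le {k n : ℕ} (h : k ≤ n) (g : ℕ → ℝ) (hg : ∀ i, k ≤ i → g i = 1) :
    ∏ i : Fin n, g i = ∏ i : Fin k, g i := by
  rw [Fin.prod_univ_eq_prod_range, Fin.prod_univ_eq_prod_range]
  refine (Finset.prod_subset (by simpa using h) fun i _ hi => hg i ?_).symm
  simpa using hi

/-- The joint rising-factorial moments of the color counts. -/
lemma sum_polyaProb_mul_prod_rising {κ : ℝ} (hκ : 0 < κ) {k n : ℕ} (hn : 0 < n) (hkn : k ≤ n)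
    (M : ℕ) (ν : Fin k → ℕ) :
    ∑ ψ : Fin M → Fin n, polyaProb κ ψ *
        ∏ i : Fin k, ∏ j ∈ Finset.range (ν i), (κ + colorCountNat ψ i + j) =
      (∏ i : Fin k, ∏ j ∈ Finset.range (ν i), (κ + j)) *
        ((∏ j ∈ Finset.range (∑ i, ν i), (κ * n + M + j)) /
          ∏ j ∈ Finset.range (∑ i, ν i), (κ * n + j)) := by
  set N : ℕ → ℕ := fun i => if h : i < k then ν ⟨i, h⟩ else 0 with hN
  have hNk (i : Fin k) : N i = ν i := by simp [hN]
  have hN0 (i : ℕ) (hi : k ≤ i) : N i = 0 := by simp [hN, not_lt.2 hi]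
  have hsum : ∑ i : Fin n, N i = ∑ i, ν i := by
    rw [Fin.sum_univ_eq_sum_range, ← Finset.sum_congr rfl fun i _ => hNk i,
      Fin.sum_univ_eq_sum_range]
    refine (Finset.sum_subset (by simpa using hkn) fun i _ hi => hN0 i ?_).symm
    simpa using hi
  have hpos (x : ℕ) : (∏ j ∈ Finset.range x, (κ * n + j)) ≠ 0 := by
    refine (Finset.prod_pos fun j _ => ?_).ne'
    positivity
  have hterm (ψ : Fin M → Fin n) :
      polyaProb κ ψ * ∏ i : Fin k, ∏ j ∈ Finset.range (ν i), (κ + colorCountNat ψ i + j) =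
        (∏ i : Fin k, ∏ j ∈ Finset.range (ν i), (κ + j)) /
          (∏ j ∈ Finset.range M, (κ * n + j)) *
        ∏ i : Fin n, ∏ j ∈ Finset.range (colorCountNat ψ i), (κ + N i + j) := by
    have h1 : ∏ i : Fin k, ∏ j ∈ Finset.range (ν i), (κ + colorCountNat ψ i + j) =
        ∏ i : Fin n, ∏ j ∈ Finset.range (N i), (κ + colorCountNat ψ i + j) := by
      rw [prod_fin_eq_prod_fin_of_le hkn
        (fun i => ∏ j ∈ Finset.range (N i), (κ + colorCountNat ψ i + j))]
      · simp only [hNk]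
      · intro i hi
        simp [hN0 i hi]
    have h2 : ∏ i : Fin k, ∏ j ∈ Finset.range (ν i), (κ + j) =
        ∏ i : Fin n, ∏ j ∈ Finset.range (N i), (κ + j) := by
      rw [prod_fin_eq_prod_fin_of_le hkn (fun i => ∏ j ∈ Finset.range (N i), (κ + j))]
      · simp only [hNk]
      · intro i hi
        simp [hN0 i hi]
    rw [h1, h2, polyaProb, div_mul_eq_mul_div, div_mul_eq_mul_div, ← Finset.prod_mul_distrib,
      ← Finset.prod_mul_distrib]
    simp only [prod_rising_mul_prod_rising]
  simp only [hterm]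
  rw [← Finset.mul_sum, sum_prod_rising (fun i : Fin n => κ + (N i : ℝ)), div_mul_eq_mul_div,
    mul_div_assoc]
  congr 1
  rw [div_eq_div_iff (hpos _) (hpos _), mul_comm]
  have hS : ∑ i : Fin n, (κ + (N i : ℝ)) = κ * n + (∑ i, ν i : ℕ) := by
    rw [Finset.sum_add_distrib, ← Nat.cast_sum, hsum]
    simp [mul_comm]
  rw [hS, mul_comm (∏ j ∈ Finset.range (∑ i, ν i), (κ * n + M + j))]
  exact (prod_rising_mul_prod_rising (κ * n) M (∑ i, ν i)).symm

lemma polyaProb_nonneg {κ : ℝ} (hκ : 0 < κ) {M n : ℕ} (ψ : Fin M → Fin n) :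
    0 ≤ polyaProb κ ψ := by
  unfold polyaProb
  positivity

lemma sum_polyaProb {κ : ℝ} (hκ : 0 < κ) {n : ℕ} (hn : 0 < n) (M : ℕ) :
    ∑ ψ : Fin M → Fin n, polyaProb κ ψ = 1 := by
  simpa using sum_polyaProb_mul_prod_rising hκ hn (Nat.zero_le n) M Fin.elim0

lemma tendsto_prod_rising_ratio {κ ρ : ℝ} (hκ : 0 < κ) {M : ℕ → ℕ}
    (hM : Tendsto (fun n : ℕ => (M n : ℝ) / (n : ℝ) ^ 2) atTop (nhds ρ)) (S : ℕ) :
    Tendsto (fun n : ℕ => ((∏ j ∈ Finset.range S, (κ * n + M n + j)) /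
      ∏ j ∈ Finset.range S, (κ * n + j)) / (n : ℝ) ^ S) atTop (nhds ((ρ / κ) ^ S)) := by
  have hinv : Tendsto (fun n : ℕ => ((n : ℝ))⁻¹) atTop (nhds 0) :=
    tendsto_inv_atTop_nhds_zero_nat
  have hfac (j : ℕ) : Tendsto (fun n : ℕ =>
      (κ * (n : ℝ)⁻¹ + (M n : ℝ) / (n : ℝ) ^ 2 + j * ((n : ℝ)⁻¹ * (n : ℝ)⁻¹)) /
        (κ + j * (n : ℝ)⁻¹)) atTop (nhds (ρ / κ)) := by
    have h := (((hinv.const_mul κ).add hM).add ((hinv.mul hinv).const_mul (j : ℝ))).div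
      ((hinv.const_mul (j : ℝ)).const_add κ) (by simpa using hκ.ne')
    simp only [mul_zero, add_zero, zero_add] at h
    exact h
  have := tendsto_finsetProd (Finset.range S) fun j _ => hfac j
  rw [Finset.prod_const, Finset.card_range] at this
  refine this.congr' ?_
  filter_upwards [eventually_gt_atTop 0] with n hn
  have hn' : (n : ℝ) ≠ 0 := by positivity
  rw [← Finset.prod_div_distrib]
  conv_rhs => rw [← Finset.card_range S, ← Finset.prod_const, Finset.card_range,
    ← Finset.prod_div_distrib]
  refine Finset.prod_congr rfl fun j _ => ?_
  have : κ * n + j ≠ 0 := by positivity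
  have : κ + j * (n : ℝ)⁻¹ ≠ 0 := by positivity
  field_simp

/-- Convergence of mixed moments: each coordinate carries a rescaled rising factorial of order
`a i` and an ordinary power of order `b i`. -/
lemma tendsto_mixed_moments {κ ρ : ℝ} (hκ : 0 < κ) {M : ℕ → ℕ}
    (hM : Tendsto (fun n : ℕ => (M n : ℝ) / (n : ℝ) ^ 2) atTop (nhds ρ)) {k : ℕ}
    (b a : Fin k → ℕ) :
    Tendsto (fun n : ℕ => ∑ ψ : Fin (M n) → Fin n, polyaProb κ ψ *
        ∏ i : Fin k, ((∏ j ∈ Finset.range (a i), (κ + colorCountNat ψ i + j)) / (n : ℝ) ^ a i *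
          ((colorCountNat ψ i : ℝ) / n) ^ b i)) atTop
      (nhds (∏ i : Fin k, (ρ / κ) ^ (a i + b i) *
        ∏ j ∈ Finset.range (a i + b i), (κ + j))) := by
  obtain ⟨s, hs⟩ : ∃ s, ∑ i, b i = s := ⟨_, rfl⟩
  induction s generalizing a b with
  | zero =>
    have hb (i : Fin k) : b i = 0 := Finset.sum_eq_zero_iff.1 hs i (Finset.mem_univ i)
    have h := (tendsto_prod_rising_ratio hκ hM (∑ i, a i)).const_mul
      (∏ i : Fin k, ∏ j ∈ Finset.range (a i), (κ + j))
    have hlim : ∏ i : Fin k, (ρ / κ) ^ (a i + b i) * ∏ j ∈ Finset.range (a i + b i), (κ + j) =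
        (∏ i : Fin k, ∏ j ∈ Finset.range (a i), (κ + j)) * (ρ / κ) ^ ∑ i, a i := by
      simp only [hb, add_zero]
      rw [Finset.prod_mul_distrib, Finset.prod_pow_eq_pow_sum, mul_comm]
    rw [hlim]
    refine h.congr' ?_
    filter_upwards [eventually_gt_atTop 0, eventually_ge_atTop k] with n hn hkn
    rw [← mul_div_assoc, ← sum_polyaProb_mul_prod_rising hκ hn hkn, Finset.sum_div]
    refine Finset.sum_congr rfl fun ψ _ => ?_
    simp only [hb, pow_zero, mul_one]
    rw [Finset.prod_div_distrib, Finset.prod_pow_eq_pow_sum, mul_div_assoc]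
  | succ s ih =>
    obtain ⟨i₀, -, hi₀⟩ : ∃ i ∈ Finset.univ, b i ≠ 0 :=
      Finset.exists_ne_zero_of_sum_ne_zero (by omega)
    obtain ⟨b, rfl⟩ : ∃ b' : Fin k → ℕ, b = b' + (Pi.single i₀ 1 : Fin k → ℕ) := by
      refine ⟨b - (Pi.single i₀ 1 : Fin k → ℕ), funext fun i => ?_⟩
      by_cases h : i = i₀
      · subst h
        simp only [Pi.add_apply, Pi.sub_apply, Pi.single_eq_same]
        omega
      · simp [h]
    have hb : ∑ i, b i = s := by
      simpa [Finset.sum_add_distrib] using hs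
    have h1 := ih b (a + (Pi.single i₀ 1 : Fin k → ℕ)) hb
    have h2 := ((tendsto_inv_atTop_nhds_zero_nat (𝕜 := ℝ)).const_mul (κ + a i₀)).mul (ih b a hb)
    have h := h1.sub h2
    simp only [mul_zero, zero_mul, sub_zero] at h
    have hlim (i : Fin k) :
        a i + (b + (Pi.single i₀ 1 : Fin k → ℕ)) i = (a + (Pi.single i₀ 1 : Fin k → ℕ)) i + b i := by
      simp only [Pi.add_apply]
      omega
    simp only [hlim]
    refine h.congr' ?_
    filter_upwards [eventually_gt_atTop 0] with n hn
    rw [Finset.mul_sum, ← Finset.sum_sub_distrib]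
    refine Finset.sum_congr rfl fun ψ _ => ?_
    rw [mul_left_comm, ← mul_sub]
    congr 1
    rw [← Finset.mul_prod_erase _ _ (Finset.mem_univ i₀),
      ← Finset.mul_prod_erase (Finset.univ : Finset (Fin k))
        (fun i => (∏ j ∈ Finset.range (a i), (κ + colorCountNat ψ i + j)) / (n : ℝ) ^ a i *
          ((colorCountNat ψ i : ℝ) / n) ^ b i) (Finset.mem_univ i₀),
      ← Finset.mul_prod_erase (Finset.univ : Finset (Fin k))
        (fun i => (∏ j ∈ Finset.range (a i), (κ + colorCountNat ψ i + j)) / (n : ℝ) ^ a i *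
          ((colorCountNat ψ i : ℝ) / n) ^ (b + (Pi.single i₀ 1 : Fin k → ℕ)) i) (Finset.mem_univ i₀)]
    have he (i : Fin k) (hi : i ∈ Finset.univ.erase i₀) : (Pi.single i₀ 1 : Fin k → ℕ) i = 0 :=
      Pi.single_eq_of_ne (Finset.ne_of_mem_erase hi) 1
    have e1 : ∏ i ∈ Finset.univ.erase i₀,
        ((∏ j ∈ Finset.range ((a + (Pi.single i₀ 1 : Fin k → ℕ)) i), (κ + colorCountNat ψ i + j)) /
          (n : ℝ) ^ (a + (Pi.single i₀ 1 : Fin k → ℕ)) i * ((colorCountNat ψ i : ℝ) / n) ^ b i) =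
        ∏ i ∈ Finset.univ.erase i₀,
        ((∏ j ∈ Finset.range (a i), (κ + colorCountNat ψ i + j)) / (n : ℝ) ^ a i *
          ((colorCountNat ψ i : ℝ) / n) ^ b i) :=
      Finset.prod_congr rfl fun i hi => by simp only [Pi.add_apply, he i hi, add_zero]
    have e2 : ∏ i ∈ Finset.univ.erase i₀,
        ((∏ j ∈ Finset.range (a i), (κ + colorCountNat ψ i + j)) / (n : ℝ) ^ a i *
          ((colorCountNat ψ i : ℝ) / n) ^ (b + (Pi.single i₀ 1 : Fin k → ℕ)) i) =
        ∏ i ∈ Finset.univ.erase i₀,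
        ((∏ j ∈ Finset.range (a i), (κ + colorCountNat ψ i + j)) / (n : ℝ) ^ a i *
          ((colorCountNat ψ i : ℝ) / n) ^ b i) :=
      Finset.prod_congr rfl fun i hi => by simp only [Pi.add_apply, he i hi, add_zero]
    rw [e1, e2, ← mul_assoc, ← sub_mul]
    congr 1
    simp only [Pi.add_apply, Pi.single_eq_same, Finset.prod_range_succ]
    have hn' : (n : ℝ) ≠ 0 := by positivity
    have hd (P Q Y x y : ℝ) : P * (y + x + a i₀) / (Q * n) * Y - (y + a i₀) * (n : ℝ)⁻¹ *
        (P / Q * Y) = P / Q * (Y * (x / n)) := by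
      field_simp
      ring
    simp only [pow_succ]
    exact hd _ _ _ _ _

lemma tendsto_moments {κ ρ : ℝ} (hκ : 0 < κ) {M : ℕ → ℕ}
    (hM : Tendsto (fun n : ℕ => (M n : ℝ) / (n : ℝ) ^ 2) atTop (nhds ρ)) {k : ℕ}
    (ν : Fin k → ℕ) :
    Tendsto (fun n : ℕ => ∑ ψ : Fin (M n) → Fin n, polyaProb κ ψ *
        ∏ i : Fin k, ((colorCountNat ψ i : ℝ) / n) ^ ν i) atTop
      (nhds (∏ i : Fin k, (ρ / κ) ^ ν i * ∏ j ∈ Finset.range (ν i), (κ + j))) := by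
  simpa using tendsto_mixed_moments hκ hM ν 0

end PolyaUrn

section MomentMethod

lemma norm_cexp_sub_sum_le_aux (J : ℕ) (s : ℝ) (hs : |s| = 1) (y : ℝ) (hy : 0 ≤ y) :
    ‖Complex.exp ((s * y : ℝ) * Complex.I) -
      ∑ j ∈ Finset.range J, ((s * y : ℝ) * Complex.I) ^ j / (j ! : ℂ)‖ ≤ y ^ J / J ! := by
  induction J generalizing y with
  | zero => simpa using (Complex.norm_exp_ofReal_mul_I (s * y)).le
  | succ J ih =>
    have hlin (x : ℝ) : HasDerivAt (fun x : ℝ => ((s * x : ℝ) : ℂ) * Complex.I)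
        (s * Complex.I) x := by
      have := (((hasDerivAt_id x).const_mul s).ofReal_comp).mul_const Complex.I
      simpa using this
    have hderiv (x : ℝ) : HasDerivAt
        (fun x : ℝ => Complex.exp ((s * x : ℝ) * Complex.I) -
          ∑ j ∈ Finset.range (J + 1), ((s * x : ℝ) * Complex.I) ^ j / j !)
        ((Complex.exp ((s * x : ℝ) * Complex.I) -
          ∑ j ∈ Finset.range J, ((s * x : ℝ) * Complex.I) ^ j / j !) * (s * Complex.I)) x := by
      rw [sub_mul]
      refine (hlin x).cexp.sub ?_
      have h := HasDerivAt.fun_sum (u := Finset.range (J + 1)) fun j _ =>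
        ((hlin x).fun_pow j).div_const (j ! : ℂ)
      refine h.congr_deriv ?_
      rw [Finset.sum_range_succ', Finset.sum_mul]
      simp only [CharP.cast_eq_zero, zero_mul, zero_div, add_zero]
      refine Finset.sum_congr rfl fun j _ => ?_
      have : (j ! : ℂ) ≠ 0 := by exact_mod_cast (Nat.factorial_pos j).ne'
      have : ((j : ℂ) + 1) ≠ 0 := by exact_mod_cast Nat.succ_ne_zero j
      rw [Nat.factorial_succ]
      push_cast
      field_simp
    refine image_norm_le_of_norm_deriv_right_le_deriv_boundary (a := 0) (b := y)
      (f := fun x : ℝ => Complex.exp ((s * x : ℝ) * Complex.I) -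
          ∑ j ∈ Finset.range (J + 1), ((s * x : ℝ) * Complex.I) ^ j / j !)
      (B := fun x => x ^ (J + 1) / (J + 1)!) (B' := fun x => x ^ J / J !)
      (fun x _ => (hderiv x).continuousAt.continuousWithinAt)
      (fun x _ => (hderiv x).hasDerivWithinAt) ?_ ?_ ?_ (Set.right_mem_Icc.2 hy)
    · simp [Finset.sum_range_succ']
    · intro x
      refine ((hasDerivAt_pow (J + 1) x).div_const _).congr_deriv ?_
      have : (J ! : ℝ) ≠ 0 := by positivity
      rw [Nat.factorial_succ]
      push_cast
      field_simp
    · intro x hx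
      rw [norm_mul, norm_mul, Complex.norm_I, Complex.norm_real, Real.norm_eq_abs, hs, mul_one,
        mul_one]
      exact ih x hx.1

/-- Taylor remainder bound for the exponential on the imaginary axis. -/
lemma norm_cexp_mul_I_sub_sum_le (J : ℕ) (y : ℝ) :
    ‖Complex.exp (y * Complex.I) - ∑ j ∈ Finset.range J, (y * Complex.I) ^ j / (j ! : ℂ)‖ ≤
      |y| ^ J / J ! := by
  rcases le_total 0 y with h | h
  · simpa [abs_of_nonneg h] using norm_cexp_sub_sum_le_aux J 1 (by simp) y h
  · simpa [abs_of_nonpos h] using norm_cexp_sub_sum_le_aux J (-1) (by simp) (-y) (by simpa using h)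

lemma integrable_pow_mul_cexp {μ : Measure ℝ} (hμ : ∀ j : ℕ, Integrable (fun x : ℝ => x ^ j) μ)
    (p : ℕ) (s : ℝ) :
    Integrable (fun x : ℝ => (x : ℂ) ^ p * Complex.exp ((s * x : ℝ) * Complex.I)) μ := by
  refine (hμ p).norm.mono' (by fun_prop) (ae_of_all _ fun x => ?_)
  rw [norm_mul, Complex.norm_exp_ofReal_mul_I]
  simp

/-- Expanding `x ↦ exp (i (s + h) x)` around `s` under the integral sign. -/
lemma norm_integral_pow_mul_cexp_sub_sum_le {μ : Measure ℝ}
    (hμ : ∀ j : ℕ, Integrable (fun x : ℝ => x ^ j) μ) (p q : ℕ) (s h : ℝ) :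
    ‖∫ x : ℝ, (x : ℂ) ^ p * Complex.exp (((s + h) * x : ℝ) * Complex.I) ∂μ -
      ∑ j ∈ Finset.range (2 * q + p), (h * Complex.I) ^ j / j ! *
        ∫ x : ℝ, (x : ℂ) ^ (p + j) * Complex.exp ((s * x : ℝ) * Complex.I) ∂μ‖ ≤
      |h| ^ (2 * q + p) / (2 * q + p)! * ∫ x : ℝ, x ^ (2 * (p + q)) ∂μ := by
  simp_rw [← integral_const_mul]
  rw [← integral_finsetSum _ fun j _ => (integrable_pow_mul_cexp hμ (p + j) s).const_mul _,
    ← integral_sub (integrable_pow_mul_cexp hμ p (s + h))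
      (integrable_finsetSum _ fun j _ => (integrable_pow_mul_cexp hμ (p + j) s).const_mul _)]
  refine norm_integral_le_of_norm_le ((hμ _).const_mul _) (ae_of_all _ fun x => ?_)
  have hx : (x : ℂ) ^ p * Complex.exp (((s + h) * x : ℝ) * Complex.I) -
      ∑ j ∈ Finset.range (2 * q + p), (h * Complex.I) ^ j / j ! *
        ((x : ℂ) ^ (p + j) * Complex.exp ((s * x : ℝ) * Complex.I)) =
      (x : ℂ) ^ p * Complex.exp ((s * x : ℝ) * Complex.I) *
        (Complex.exp ((h * x : ℝ) * Complex.I) -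
          ∑ j ∈ Finset.range (2 * q + p), ((h * x : ℝ) * Complex.I) ^ j / j !) := by
    rw [mul_sub, Finset.mul_sum]
    congr 1
    · rw [mul_assoc, ← Complex.exp_add]
      push_cast
      ring_nf
    · refine Finset.sum_congr rfl fun j _ => ?_
      push_cast
      ring
  rw [hx, norm_mul, norm_mul, Complex.norm_exp_ofReal_mul_I, mul_one, norm_pow, Complex.norm_real,
    Real.norm_eq_abs]
  refine (mul_le_mul_of_nonneg_left (norm_cexp_mul_I_sub_sum_le _ _) (by positivity)).trans_eq ?_
  have he : x ^ (2 * (p + q)) = |x| ^ (2 * (p + q)) := by rw [pow_mul, pow_mul, sq_abs]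
  rw [he, abs_mul, mul_pow]
  ring

lemma abs_pow_le_factorial_mul_exp {r : ℝ} (hr : 0 < r) (x : ℝ) (p : ℕ) :
    |x| ^ p ≤ p ! / r ^ p * Real.exp (r * |x|) := by
  have h := Real.pow_div_factorial_le_exp (r * |x|) (by positivity) p
  rw [div_le_iff₀ (by positivity), mul_pow] at h
  rw [div_mul_eq_mul_div, le_div_iff₀ (by positivity)]
  linarith

lemma integrable_pow_of_integrable_exp {ν : Measure ℝ} {r : ℝ} (hr : 0 < r)
    (hexp : Integrable (fun x => Real.exp (r * |x|)) ν) (p : ℕ) :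
    Integrable (fun x : ℝ => x ^ p) ν := by
  refine (hexp.const_mul (p ! / r ^ p)).mono' (by fun_prop) (ae_of_all _ fun x => ?_)
  rw [norm_pow, Real.norm_eq_abs]
  exact abs_pow_le_factorial_mul_exp hr x p

lemma tendsto_pow_div_factorial_mul_integral_pow {ν : Measure ℝ} {r : ℝ} (hr : 0 < r)
    (hexp : Integrable (fun x => Real.exp (r * |x|)) ν) {h : ℝ} (hh : |h| ≤ r / 2) (p : ℕ) :
    Tendsto (fun q : ℕ => |h| ^ (2 * q + p) / (2 * q + p)! * ∫ x : ℝ, x ^ (2 * (p + q)) ∂ν)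
      atTop (nhds 0) := by
  simp_rw [← integral_const_mul]
  have he (q : ℕ) (x : ℝ) : |h| ^ (2 * q + p) / (2 * q + p)! * x ^ (2 * (p + q)) =
      |x| ^ p * ((|h| * |x|) ^ (2 * q + p) / (2 * q + p)!) := by
    have : x ^ (2 * (p + q)) = |x| ^ (2 * (p + q)) := by rw [pow_mul, pow_mul, sq_abs]
    rw [this, mul_pow]
    ring
  rw [← integral_zero ℝ ℝ (μ := ν)]
  refine tendsto_integral_of_dominated_convergence
    (fun x => p ! / (r / 2) ^ p * Real.exp (r * |x|)) (fun q => by fun_prop)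
    (hexp.const_mul _) (fun q => ae_of_all _ fun x => ?_) (ae_of_all _ fun x => ?_)
  · rw [he, Real.norm_of_nonneg (by positivity)]
    have h1 := abs_pow_le_factorial_mul_exp (half_pos hr) x p
    have h2 := Real.pow_div_factorial_le_exp (|h| * |x|) (by positivity) (2 * q + p)
    have h3 : Real.exp (|h| * |x|) ≤ Real.exp (r / 2 * |x|) :=
      Real.exp_le_exp.2 (mul_le_mul_of_nonneg_right hh (abs_nonneg x))
    calc |x| ^ p * ((|h| * |x|) ^ (2 * q + p) / (2 * q + p)!)
        ≤ (p ! / (r / 2) ^ p * Real.exp (r / 2 * |x|)) * Real.exp (r / 2 * |x|) :=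
          mul_le_mul h1 (h2.trans h3) (by positivity) (by positivity)
      _ = p ! / (r / 2) ^ p * Real.exp (r * |x|) := by
          rw [mul_assoc, ← Real.exp_add]
          ring_nf
  · simp only [he]
    have hsub : Tendsto (fun q : ℕ => 2 * q + p) atTop atTop :=
      tendsto_atTop_mono (fun q => show q ≤ 2 * q + p by omega) tendsto_id
    simpa using ((FloorSemiring.tendsto_pow_div_factorial_atTop (|h| * |x|)).comp hsub).const_mul
      (|x| ^ p)

/-- If `a` is approximated by `A q` up to errors `b q` stable under the limit along the sequence
and vanishing as `q → ∞`, then `a` converges. -/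
lemma tendsto_of_uniform_approx {E : Type*} [SeminormedAddCommGroup E] {a : ℕ → E} {a₀ : E}
    {A : ℕ → ℕ → E} {A₀ : ℕ → E} {b : ℕ → ℕ → ℝ} {b₀ : ℕ → ℝ}
    (ha : ∀ q n, ‖a n - A q n‖ ≤ b q n) (ha₀ : ∀ q, ‖a₀ - A₀ q‖ ≤ b₀ q)
    (hA : ∀ q, Tendsto (A q) atTop (nhds (A₀ q))) (hb : ∀ q, Tendsto (b q) atTop (nhds (b₀ q)))
    (hb₀ : Tendsto b₀ atTop (nhds 0)) : Tendsto a atTop (nhds a₀) := by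
  rw [Metric.tendsto_atTop']
  intro ε hε
  obtain ⟨q, hq⟩ := (hb₀.eventually_lt_const (show 0 < ε / 4 by positivity)).exists
  have h1 := (hb q).eventually_lt_const hq
  have h2 := (Metric.tendsto_nhds.1 (hA q)) (ε / 4) (by positivity)
  obtain ⟨N, hN⟩ := eventually_atTop.1 (h1.and h2)
  refine ⟨N, fun n hn => ?_⟩
  obtain ⟨h3, h4⟩ := hN n hn.le
  have h5 := ha q n
  have h6 := ha₀ q
  rw [dist_eq_norm] at h4 ⊢
  have h7 : a n - a₀ = (a n - A q n) + (A q n - A₀ q) - (a₀ - A₀ q) := by abel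
  rw [h7]
  have h8 := norm_sub_le ((a n - A q n) + (A q n - A₀ q)) (a₀ - A₀ q)
  have h9 := norm_add_le (a n - A q n) (A q n - A₀ q)
  linarith

/-- Method of moments on the real line: convergence of all moments to those of a measure with an
exponential moment implies convergence of characteristic functions. -/
lemma tendsto_charFun_of_tendsto_moments {μ : ℕ → Measure ℝ} {ν : Measure ℝ}
    (hμ : ∀ n (j : ℕ), Integrable (fun x : ℝ => x ^ j) (μ n)) {r : ℝ} (hr : 0 < r)
    (hexp : Integrable (fun x => Real.exp (r * |x|)) ν)
    (hmom : ∀ j : ℕ, Tendsto (fun n => ∫ x : ℝ, x ^ j ∂μ n) atTop (nhds (∫ x : ℝ, x ^ j ∂ν)))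
    (t : ℝ) : Tendsto (fun n => charFun (μ n) t) atTop (nhds (charFun ν t)) := by
  have hν := integrable_pow_of_integrable_exp hr hexp
  have hstep (h : ℝ) (hh : |h| ≤ r / 2) (m p : ℕ) :
      Tendsto (fun n => ∫ x : ℝ, (x : ℂ) ^ p * Complex.exp ((m * h * x : ℝ) * Complex.I) ∂μ n)
        atTop
        (nhds (∫ x : ℝ, (x : ℂ) ^ p * Complex.exp ((m * h * x : ℝ) * Complex.I) ∂ν)) := by
    induction m generalizing p with
    | zero =>
      have hc (μ : Measure ℝ) :
          ∫ x : ℝ, (x : ℂ) ^ p * Complex.exp (((0 : ℕ) * h * x : ℝ) * Complex.I) ∂μ =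
            ((∫ x : ℝ, x ^ p ∂μ : ℝ) : ℂ) := by
        rw [← integral_complex_ofReal]
        simp
      simp only [hc]
      exact (Complex.continuous_ofReal.tendsto _).comp (hmom p)
    | succ m ih =>
      have hm : ((m + 1 : ℕ) : ℝ) * h = m * h + h := by
        push_cast
        ring
      rw [hm]
      exact tendsto_of_uniform_approx
        (fun q n => norm_integral_pow_mul_cexp_sub_sum_le (hμ n) p q (m * h) h)
        (fun q => norm_integral_pow_mul_cexp_sub_sum_le hν p q (m * h) h)
        (fun q => tendsto_finsetSum _ fun j _ => (ih (p + j)).const_mul _)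
        (fun q => (hmom (2 * (p + q))).const_mul _)
        (tendsto_pow_div_factorial_mul_integral_pow hr hexp hh p)
  obtain ⟨N, hN⟩ := exists_nat_gt (|t| / (r / 2))
  have hN0 : (0 : ℝ) < N := lt_of_le_of_lt (by positivity) hN
  have hh : |t / N| ≤ r / 2 := by
    rw [abs_div, Nat.abs_cast, div_le_iff₀ hN0]
    rw [div_lt_iff₀ (by positivity)] at hN
    linarith
  have h := hstep (t / N) hh N 0
  rw [mul_div_cancel₀ t hN0.ne'] at h
  simpa [charFun_apply_real] using h

end MomentMethod

section GammaMoments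

open scoped ENNReal

lemma ae_nonneg_gammaMeasure (a r : ℝ) : ∀ᵐ x ∂gammaMeasure a r, 0 ≤ x := by
  rw [gammaMeasure, ae_withDensity_iff (f := gammaPDF a r) (by
    unfold gammaPDF; exact (measurable_gammaPDFReal a r).ennreal_ofReal)]
  refine ae_of_all _ fun x hx => ?_
  by_contra h
  exact hx (gammaPDF_of_neg (not_le.1 h))

/-- A function whose product with a gamma density is a constant multiple of another gamma density
is integrable, and its integral is that constant. -/
lemma integrable_and_integral_gammaMeasure {a r a' r' c : ℝ} (ha : 0 < a) (hr : 0 < r)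
    (ha' : 0 < a') (hr' : 0 < r') (hc : 0 ≤ c) {g : ℝ → ℝ} (hg : Measurable g)
    (hg0 : ∀ x, 0 ≤ x → 0 ≤ g x)
    (h : ∀ x, 0 < x → gammaPDFReal a r x * g x = c * gammaPDFReal a' r' x) :
    Integrable g (gammaMeasure a r) ∧ ∫ x, g x ∂gammaMeasure a r = c := by
  have hnn : 0 ≤ᵐ[gammaMeasure a r] g := by
    filter_upwards [ae_nonneg_gammaMeasure a r] with x hx using hg0 x hx
  have hm : Measurable (gammaPDF a r) := (measurable_gammaPDFReal a r).ennreal_ofReal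
  have hm' : Measurable (gammaPDF a' r') := (measurable_gammaPDFReal a' r').ennreal_ofReal
  have hl : ∫⁻ x, ENNReal.ofReal (g x) ∂gammaMeasure a r = ENNReal.ofReal c := by
    rw [gammaMeasure, lintegral_withDensity_eq_lintegral_mul _ hm hg.ennreal_ofReal]
    calc ∫⁻ x, (gammaPDF a r * fun x => ENNReal.ofReal (g x)) x
        = ∫⁻ x, ENNReal.ofReal c * gammaPDF a' r' x := by
          refine lintegral_congr_ae ?_
          filter_upwards [Measure.ae_ne volume (0 : ℝ)] with x hx
          rcases lt_or_gt_of_ne hx with hx | hx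
          · simp [gammaPDF_of_neg hx]
          · simp only [Pi.mul_apply, gammaPDF]
            rw [← ENNReal.ofReal_mul (gammaPDFReal_nonneg ha hr x), h x hx, ENNReal.ofReal_mul hc]
      _ = ENNReal.ofReal c := by
          rw [lintegral_const_mul _ hm', lintegral_gammaPDF_eq_one ha' hr', mul_one]
  refine ⟨(lintegral_ofReal_ne_top_iff_integrable hg.aestronglyMeasurable hnn).1 ?_, ?_⟩
  · rw [hl]
    exact ENNReal.ofReal_ne_top
  · rw [integral_eq_lintegral_of_nonneg_ae hnn hg.aestronglyMeasurable, hl,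
      ENNReal.toReal_ofReal hc]

lemma Gamma_add_nat {a : ℝ} (ha : 0 < a) (p : ℕ) :
    Real.Gamma (a + p) = (∏ j ∈ Finset.range p, (a + j)) * Real.Gamma a := by
  induction p with
  | zero => simp
  | succ p ih =>
    have : a + (p + 1 : ℕ) = (a + p) + 1 := by
      push_cast
      ring
    rw [this, Real.Gamma_add_one (by positivity), ih, Finset.prod_range_succ]
    ring

lemma integral_pow_gammaMeasure {a r : ℝ} (ha : 0 < a) (hr : 0 < r) (p : ℕ) :
    Integrable (fun x : ℝ => x ^ p) (gammaMeasure a r) ∧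
      ∫ x, x ^ p ∂gammaMeasure a r = r⁻¹ ^ p * ∏ j ∈ Finset.range p, (a + j) := by
  refine integrable_and_integral_gammaMeasure (a' := a + p) (r' := r) ha hr (by positivity) hr
    (by positivity) (by fun_prop) (fun x hx => by positivity) fun x hx => ?_
  have hG := Real.Gamma_pos_of_pos ha
  have hP : 0 < ∏ j ∈ Finset.range p, (a + j) := Finset.prod_pos fun j _ => by positivity
  have hx' : x ^ (a + p - 1) = x ^ (a - 1) * x ^ p := by
    rw [← Real.rpow_natCast, ← Real.rpow_add hx]
    ring_nf
  rw [gammaPDFReal, gammaPDFReal, if_pos hx.le, if_pos hx.le, Gamma_add_nat ha, hx',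
    Real.rpow_add hr, Real.rpow_natCast, inv_pow]
  field_simp

lemma integrable_exp_abs_gammaMeasure {a r : ℝ} (ha : 0 < a) (hr : 0 < r) {s : ℝ}
    (hs : s < r) : Integrable (fun x => Real.exp (s * |x|)) (gammaMeasure a r) := by
  have hG := Real.Gamma_pos_of_pos ha
  have hrs : 0 < r - s := sub_pos.2 hs
  refine (integrable_and_integral_gammaMeasure (a' := a) (r' := r - s)
    (c := r ^ a / (r - s) ^ a) ha hr ha hrs (by positivity) (by fun_prop)
    (fun x hx => by positivity) fun x hx => ?_).1
  have he : Real.exp (-((r - s) * x)) = Real.exp (-(r * x)) * Real.exp (s * x) := by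
    rw [← Real.exp_add]
    ring_nf
  have := Real.rpow_pos_of_pos hrs a
  rw [gammaPDFReal, gammaPDFReal, if_pos hx.le, if_pos hx.le, abs_of_pos hx, he]
  field_simp

end GammaMoments

section MultivariateMomentMethod

/-- Method of moments in finite dimension: convergence of all mixed moments to those of a
probability measure with an exponential moment implies convergence in distribution. -/
lemma tendsto_integral_of_tendsto_moments {k : ℕ} {μ : ℕ → Measure (Fin k → ℝ)}
    {ν : Measure (Fin k → ℝ)} [∀ n, IsProbabilityMeasure (μ n)] [IsProbabilityMeasure ν]
    (hμ : ∀ n (p : Fin k → ℕ), Integrable (fun x : Fin k → ℝ => ∏ i, x i ^ p i) (μ n))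
    {r : ℝ} (hr : 0 < r)
    (hexp : Integrable (fun x : Fin k → ℝ => Real.exp (r * ∑ i, |x i|)) ν)
    (hmom : ∀ p : Fin k → ℕ, Tendsto (fun n => ∫ x : Fin k → ℝ, ∏ i, x i ^ p i ∂μ n) atTop
      (nhds (∫ x : Fin k → ℝ, ∏ i, x i ^ p i ∂ν)))
    {f : (Fin k → ℝ) → ℝ} (hf : Continuous f) {C : ℝ} (hC : ∀ x, |f x| ≤ C) :
    Tendsto (fun n => ∫ x, f x ∂μ n) atTop (nhds (∫ x, f x ∂ν)) := by
  have hν (p : Fin k → ℕ) : Integrable (fun x : Fin k → ℝ => ∏ i, x i ^ p i) ν := by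
    refine (hexp.const_mul (∏ i, ((p i)! / r ^ p i : ℝ))).mono'
      (Measurable.aestronglyMeasurable (by fun_prop)) (ae_of_all _ fun x => ?_)
    rw [Finset.mul_sum, Real.exp_sum, ← Finset.prod_mul_distrib, norm_prod]
    refine Finset.prod_le_prod (fun i _ => norm_nonneg _) fun i _ => ?_
    rw [norm_pow, Real.norm_eq_abs]
    exact abs_pow_le_factorial_mul_exp hr (x i) (p i)
  have hpow (t : Fin k → ℝ) (j : ℕ) (x : Fin k → ℝ) : (∑ i, t i * x i) ^ j =
      ∑ p ∈ (Finset.univ : Finset (Fin k)).piAntidiag j,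
        (Nat.multinomial Finset.univ p * ∏ i, t i ^ p i) * ∏ i, x i ^ p i := by
    rw [Finset.sum_pow_eq_sum_piAntidiag]
    refine Finset.sum_congr rfl fun p _ => ?_
    rw [mul_assoc, ← Finset.prod_mul_distrib]
    simp only [mul_pow]
  have hL (t : Fin k → ℝ) : Measurable fun x : Fin k → ℝ => ∑ i, t i * x i := by fun_prop
  have hpow_int {m : Measure (Fin k → ℝ)}
      (hm : ∀ p : Fin k → ℕ, Integrable (fun x : Fin k → ℝ => ∏ i, x i ^ p i) m)
      (t : Fin k → ℝ) (j : ℕ) : Integrable (fun x => (∑ i, t i * x i) ^ j) m := by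
    simp only [hpow]
    exact integrable_finsetSum _ fun p _ => (hm p).const_mul _
  have hline (t : Fin k → ℝ) (u : ℝ) :
      Tendsto (fun n => charFun ((μ n).map fun x => ∑ i, t i * x i) u) atTop
        (nhds (charFun (ν.map fun x => ∑ i, t i * x i) u)) := by
    have hT : 0 < 1 + ∑ i, |t i| := by positivity
    refine tendsto_charFun_of_tendsto_moments (r := r / (1 + ∑ i, |t i|)) (fun n j => ?_)
      (by positivity) ?_ (fun j => ?_) u
    · rw [integrable_map_measure (by fun_prop) (hL t).aemeasurable]
      exact hpow_int (hμ n) t j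
    · rw [integrable_map_measure (by fun_prop) (hL t).aemeasurable]
      refine hexp.mono' (Measurable.aestronglyMeasurable (by fun_prop)) (ae_of_all _ fun x => ?_)
      simp only [Function.comp_apply, Real.norm_eq_abs, Real.abs_exp]
      refine Real.exp_le_exp.2 ?_
      have h : |∑ i, t i * x i| ≤ (1 + ∑ i, |t i|) * ∑ i, |x i| := by
        refine (Finset.abs_sum_le_sum_abs _ _).trans ?_
        rw [Finset.mul_sum]
        refine Finset.sum_le_sum fun i _ => ?_
        rw [abs_mul]
        refine mul_le_mul_of_nonneg_right ?_ (abs_nonneg _)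
        have := Finset.single_le_sum (fun j _ => abs_nonneg (t j)) (Finset.mem_univ i)
        linarith
      rw [div_mul_eq_mul_div, div_le_iff₀ hT]
      nlinarith
    · have hm {m : Measure (Fin k → ℝ)}
          (hm : ∀ p : Fin k → ℕ, Integrable (fun x : Fin k → ℝ => ∏ i, x i ^ p i) m) :
          ∫ y, y ^ j ∂(m.map fun x => ∑ i, t i * x i) =
            ∑ p ∈ (Finset.univ : Finset (Fin k)).piAntidiag j,
              (Nat.multinomial Finset.univ p * ∏ i, t i ^ p i) *
                ∫ x : Fin k → ℝ, ∏ i, x i ^ p i ∂m := by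
        rw [integral_map (hL t).aemeasurable (by fun_prop)]
        simp only [hpow]
        rw [integral_finsetSum _ fun p _ => (hm p).const_mul _]
        simp only [integral_const_mul]
      simp only [hm (hμ _), hm hν]
      exact tendsto_finsetSum _ fun p _ => (hmom p).const_mul _
  have hto : Measurable (WithLp.toLp 2 : (Fin k → ℝ) → EuclideanSpace ℝ (Fin k)) := by fun_prop
  have hP (m : Measure (Fin k → ℝ)) [IsProbabilityMeasure m] :
      IsProbabilityMeasure (m.map (WithLp.toLp 2 : _ → EuclideanSpace ℝ (Fin k))) :=
    Measure.isProbabilityMeasure_map hto.aemeasurable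
  let P (m : Measure (Fin k → ℝ)) [IsProbabilityMeasure m] :
      ProbabilityMeasure (EuclideanSpace ℝ (Fin k)) := ⟨m.map (WithLp.toLp 2), hP m⟩
  have hchar (m : Measure (Fin k → ℝ)) [IsProbabilityMeasure m]
      (t : EuclideanSpace ℝ (Fin k)) :
      charFun (P m : Measure (EuclideanSpace ℝ (Fin k))) t =
        charFun (m.map fun x => ∑ i, t i * x i) 1 := by
    simp only [P, ProbabilityMeasure.coe_mk]
    rw [charFun_apply, charFun_apply, integral_map hto.aemeasurable (by fun_prop),
      integral_map (hL _).aemeasurable (by fun_prop)]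
    simp [PiLp.inner_apply]
  have hweak : Tendsto (fun n => P (μ n)) atTop (nhds (P ν)) := by
    refine ProbabilityMeasure.tendsto_of_tendsto_charFun fun t => ?_
    simp only [hchar]
    exact hline _ 1
  have h := ProbabilityMeasure.tendsto_iff_forall_integral_tendsto.1 hweak
    (BoundedContinuousFunction.ofNormedAddCommGroup
      (fun x : EuclideanSpace ℝ (Fin k) => f x.ofLp) (by fun_prop) C fun x => hC _)
  have hfi (m : Measure (Fin k → ℝ)) [IsProbabilityMeasure m] :
      ∫ x : EuclideanSpace ℝ (Fin k), f x.ofLp ∂(P m : Measure (EuclideanSpace ℝ (Fin k))) =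
        ∫ x, f x ∂m := by
    simp only [P, ProbabilityMeasure.coe_mk]
    rw [integral_map hto.aemeasurable
      (by exact (hf.comp (PiLp.continuous_ofLp 2 _)).aestronglyMeasurable)]
  simpa only [BoundedContinuousFunction.coe_ofNormedAddCommGroup, hfi] using h

end MultivariateMomentMethod

section UrnLaw

/-- The law of the rescaled counts of the first `k` colors. -/
noncomputable def urnLaw (κ : ℝ) (M n k : ℕ) : Measure (Fin k → ℝ) :=
  ∑ ψ : Fin M → Fin n, ENNReal.ofReal (polyaProb κ ψ) •
    Measure.dirac fun i : Fin k => (colorCountNat ψ i : ℝ) / n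

lemma integrable_urnLaw (κ : ℝ) (M n k : ℕ) (f : (Fin k → ℝ) → ℝ) :
    Integrable f (urnLaw κ M n k) := by
  rw [urnLaw, integrable_finsetSum_measure]
  exact fun ψ _ => (integrable_dirac enorm_lt_top).smul_measure ENNReal.ofReal_ne_top

lemma integral_urnLaw {κ : ℝ} (hκ : 0 < κ) (M n k : ℕ) (f : (Fin k → ℝ) → ℝ) :
    ∫ x, f x ∂urnLaw κ M n k =
      ∑ ψ : Fin M → Fin n, polyaProb κ ψ * f fun i => (colorCountNat ψ i : ℝ) / n := by
  rw [urnLaw, integral_finsetSum_measure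
    fun ψ _ => (integrable_dirac enorm_lt_top).smul_measure ENNReal.ofReal_ne_top]
  refine Finset.sum_congr rfl fun ψ _ => ?_
  rw [integral_smul_measure, integral_dirac, ENNReal.toReal_ofReal (polyaProb_nonneg hκ ψ),
    smul_eq_mul]

lemma isProbabilityMeasure_urnLaw {κ : ℝ} (hκ : 0 < κ) (M : ℕ) {n : ℕ} (hn : 0 < n) (k : ℕ) :
    IsProbabilityMeasure (urnLaw κ M n k) := by
  constructor
  simp only [urnLaw, Measure.coe_finsetSum, Finset.sum_apply, Measure.smul_apply, measure_univ,
    smul_eq_mul, mul_one]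
  rw [← ENNReal.ofReal_sum_of_nonneg fun ψ _ => polyaProb_nonneg hκ ψ, sum_polyaProb hκ hn,
    ENNReal.ofReal_one]

end UrnLaw

/-- Let `Ψ^n` be the Pólya urn configuration with `n` colors, `2m(n)`
balls and parameter `κ > 0`, where `2m(n)/n² → ρ ∈ (0,∞)`.  Then for every `k` and all
exponents `ν_1,…,ν_k`, the joint moments of the rescaled color counts converge:
`lim_n E[∏_i ((1/n)d(Ψ^n,i))^{ν_i}] = ∏_i (ρ/κ)^{ν_i} ∏_{j=1}^{ν_i}(κ+j−1)`;
consequently `((1/n)d(Ψ^n,i))_{i<k}` converges in distribution to `k` i.i.d.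
`Gamma(κ, κ/ρ)` random variables. -/
theorem polya_rescaled_degrees_to_gamma (κ ρ : ℝ) (hκ : 0 < κ) (hρ : 0 < ρ)
    (m : ℕ → ℕ)
    (hm : Tendsto (fun n : ℕ => (2 * m n : ℝ) / (n : ℝ) ^ 2) atTop (nhds ρ))
    (k : ℕ) :
    (∀ ν : Fin k → ℕ,
      Tendsto
        (fun n : ℕ => ∑ ψ : Fin (2 * m n) → Fin n,
          polyaProb κ ψ * ∏ i : Fin k, ((colorCountNat ψ i : ℝ) / n) ^ (ν i))
        atTop
        (nhds (∏ i : Fin k,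
          (ρ / κ) ^ (ν i) * ∏ j ∈ Finset.range (ν i), (κ + j)))) ∧
    (∀ f : (Fin k → ℝ) → ℝ, Continuous f → (∃ C, ∀ x, |f x| ≤ C) →
      Tendsto
        (fun n : ℕ => ∑ ψ : Fin (2 * m n) → Fin n,
          polyaProb κ ψ * f (fun i => (colorCountNat ψ i : ℝ) / n))
        atTop
        (nhds (∫ x : Fin k → ℝ, f x
          ∂ (Measure.pi fun _ : Fin k => gammaMeasure κ (κ / ρ))))) := by
  have hM : Tendsto (fun n : ℕ => ((2 * m n : ℕ) : ℝ) / (n : ℝ) ^ 2) atTop (nhds ρ) := by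
    simpa using hm
  have hmoments (ν : Fin k → ℕ) := tendsto_moments hκ hM ν
  refine ⟨hmoments, fun f hf ⟨C, hC⟩ => ?_⟩
  have hβ : 0 < κ / ρ := by positivity
  have hγ := isProbabilityMeasure_gammaMeasure hκ hβ
  have hprob (n : ℕ) := isProbabilityMeasure_urnLaw hκ (2 * m (n + 1)) n.succ_pos k
  rw [← tendsto_add_atTop_iff_nat 1]
  simp_rw [← integral_urnLaw hκ]
  refine tendsto_integral_of_tendsto_moments (r := κ / ρ / 2)
    (fun n p => integrable_urnLaw _ _ _ _ _) (by positivity) ?_ (fun p => ?_) hf hC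
  · simp_rw [Finset.mul_sum, Real.exp_sum]
    exact Integrable.fintype_prod fun i =>
      integrable_exp_abs_gammaMeasure hκ hβ (half_lt_self hβ)
  · simp_rw [integral_urnLaw hκ]
    rw [integral_fintype_prod_eq_prod fun (i : Fin k) (x : ℝ) => x ^ p i]
    simp_rw [(integral_pow_gammaMeasure hκ hβ _).2, inv_div]
    exact (tendsto_add_atTop_iff_nat 1).2 (hmoments p)
end

section
/- (Poisson approximation for the configuration model.) Fix ε > 0, k ∈ ℕ and A ∈ A_k. Let X_n be the configuration-model random multigraph on n vertices with degree sequence (d_1,...,d_n), m = (1/2)Σd_i edges, z_i = d_i/n, ρ_n = 2m/n². If ε ≤ ρ_n ≤ 1/ε and z_i ≤ 1/ε for i ∈ [k], then P(X_n^{[k]} = A) = exp(−(Σ_{i≤k} z_i)²/(2ρ_n)) · ∏_{i≤j≤k} (1/A*(i,j)!) · ∏_{i=1}^k z_i^{d(A,i)} · ρ_n^{−m_{[k]}} · 2^{−Σ_i A*(i,i)} + Err(n,A,ε), with Err(n,A,ε) → 0 as n → ∞ uniformly over degree sequences satisfying the constraints, where A*(i,j) = A(i,j) for i<j, A*(i,i)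 = A(i,i)/2, m_{[k]} = (1/2)Σ_{i,j≤k}A(i,j), d(A,i) = Σ_j A(i,j). -/
open Finset Nat Filter

/-- The number of balls of color `i` in the urn configuration `ψ`. -/
def colorCount {M n : ℕ} (ψ : Fin M → Fin n) (i : Fin n) : ℕ :=
  (Finset.univ.filter fun l => ψ l = i).card

/-- The adjacency matrix obtained from `ψ : [2m] → [n]` by the stub-pairing map. -/
def stubAdj {m n : ℕ} (ψ : Fin (2 * m) → Fin n) (i j : Fin n) : ℕ :=
  ∑ e : Fin m,
    ((if ψ ⟨2 * (e : ℕ), by have := e.isLt; omega⟩ = i ∧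
         ψ ⟨2 * (e : ℕ) + 1, by have := e.isLt; omega⟩ = j then 1 else 0) +
     (if ψ ⟨2 * (e : ℕ), by have := e.isLt; omega⟩ = j ∧
         ψ ⟨2 * (e : ℕ) + 1, by have := e.isLt; omega⟩ = i then 1 else 0))

/-- `A*(i,j)`: `A(i,j)` off the diagonal, `A(i,i)/2` on the diagonal. -/
def Astar {k : ℕ} (A : Fin k → Fin k → ℕ) (i j : Fin k) : ℕ :=
  if i = j then A i i / 2 else A i j

/-- The degree `d(A,i) = ∑_j A(i,j)`. -/
def degA {k : ℕ} (A : Fin k → Fin k → ℕ) (i : Fin k) : ℕ := ∑ j, A i j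

open scoped Finset

section Counting

variable {α ι κ : Type*} [Fintype α] [DecidableEq ι]

/-- Two functions with the same fibre sizes differ by a permutation of the domain. -/
lemma exists_perm_comp_eq_of_card_fiber_eq {f g : α → ι}
    (h : ∀ t, #{x | f x = t} = #{x | g x = t}) : ∃ σ : Equiv.Perm α, g ∘ σ = f := by
  have e : ∀ t, {x // f x = t} ≃ {x // g x = t} := fun t =>
    Fintype.equivOfCardEq (by simpa only [Fintype.card_subtype] using h t)
  exact ⟨Equiv.ofFiberEquiv e, funext fun x => Equiv.ofFiberEquiv_map e x⟩

lemma card_fiber_comp_perm (f : α → ι) (σ : Equiv.Perm α) (t : ι) :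
    #{x | (f ∘ σ) x = t} = #{x | f x = t} :=
  Finset.card_equiv σ (by simp)

lemma exists_fun_card_fiber_eq [Fintype ι] (c : ι → ℕ) (hc : ∑ t, c t = Fintype.card α) :
    ∃ f : α → ι, ∀ t, #{x | f x = t} = c t := by
  have e : α ≃ Σ t, Fin (c t) := Fintype.equivOfCardEq (by simp [hc])
  refine ⟨fun x => (e x).1, fun t => ?_⟩
  have h1 : #{x | (e x).1 = t} = #{y : Σ t, Fin (c t) | y.1 = t} :=
    Finset.card_equiv e (by simp)
  rw [h1, ← Fintype.card_subtype, Fintype.card_congr (Equiv.sigmaSubtype t), Fintype.card_fin]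

/-- The number of functions with prescribed fibre sizes is a multinomial coefficient. -/
lemma card_fun_card_fiber_eq_mul_prod_factorial [DecidableEq α] [Fintype ι] (c : ι → ℕ)
    (hc : ∑ t, c t = Fintype.card α) :
    #{f : α → ι | ∀ t, #{x | f x = t} = c t} * ∏ t, (c t)! = (Fintype.card α)! := by
  obtain ⟨f₀, hf₀⟩ := exists_fun_card_fiber_eq (α := α) c hc
  rw [← Fintype.card_perm, ← Finset.card_univ,
    Finset.card_eq_sum_card_fiberwise (f := fun σ : Equiv.Perm α => f₀ ∘ σ)
      (t := {f : α → ι | ∀ t, #{x | f x = t} = c t})]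
  · rw [Finset.sum_const_nat]
    intro f hf
    obtain ⟨τ, hτ⟩ := exists_perm_comp_eq_of_card_fiber_eq (f := f) (g := f₀) fun t => by
      rw [hf₀, (Finset.mem_filter.mp hf).2 t]
    have h := DomMulAct.stabilizer_card f₀
    simp only [Fintype.card_subtype, hf₀] at h
    rw [← h]
    refine Finset.card_equiv (Equiv.mulRight τ⁻¹) fun σ => ?_
    simp only [Finset.mem_filter, Finset.mem_univ, true_and, Equiv.coe_mulRight, ← hτ]
    constructor
    · intro h1
      ext x
      simpa using congrFun h1 (τ⁻¹ x)
    · intro h1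
      ext x
      simpa using congrFun h1 (τ x)
  · intro σ _
    simp [← hf₀, ← card_fiber_comp_perm f₀ σ]

/-- Functions whose composition with `s` has prescribed fibre sizes. -/
lemma card_fun_card_fiber_comp_eq_mul_prod_factorial [DecidableEq α] [Fintype ι] [Fintype κ]
    (s : κ → ι) (c : ι → ℕ)
    (hc : ∑ t, c t = Fintype.card α) :
    #{f : α → κ | ∀ t, #{x | s (f x) = t} = c t} * ∏ t, (c t)! =
      (Fintype.card α)! * ∏ t, #{p | s p = t} ^ c t := by
  rw [← card_fun_card_fiber_eq_mul_prod_factorial c hc, mul_right_comm]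
  congr 1
  rw [Finset.card_eq_sum_card_fiberwise (f := fun f : α → κ => s ∘ f)
      (t := {g : α → ι | ∀ t, #{x | g x = t} = c t}) (by intro f; simp),
    Finset.sum_const_nat]
  intro g hg
  replace hg := (Finset.mem_filter.mp hg).2
  have h1 : ({f ∈ ({f : α → κ | ∀ t, #{x | s (f x) = t} = c t} : Finset _) | s ∘ f = g}) =
      Fintype.piFinset fun x => {p | s p = g x} := by
    ext f
    simp only [Finset.mem_filter, Finset.mem_univ, true_and, Fintype.mem_piFinset]
    constructor
    · rintro ⟨-, rfl⟩ x
      rfl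
    · intro h
      obtain rfl : s ∘ f = g := funext h
      exact ⟨hg, rfl⟩
  rw [h1, Fintype.card_piFinset, ← Finset.prod_fiberwise _ g]
  refine Finset.prod_congr rfl fun t _ => ?_
  rw [← hg t]
  refine Finset.prod_eq_pow_card fun x hx => ?_
  rw [(Finset.mem_filter.mp hx).2]

/-- The number of lifts along `p` with prescribed fibre sizes, of functions with prescribed fibre
sizes satisfying a given property, is proportional to the number of functions lifted. -/
lemma exists_card_lift_eq_mul [DecidableEq α] [Fintype ι] [Fintype κ] [DecidableEq κ]
    (p : κ → ι) (d : κ → ℕ) (hd : ∑ i, d i = Fintype.card α) :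
    ∃ K : ℕ, 0 < K ∧ ∀ (P : (α → ι) → Prop) [DecidablePred P],
      #{f : α → κ | (∀ i, #{x | f x = i} = d i) ∧ P (p ∘ f)} =
        #{g : α → ι | (∀ t, #{x | g x = t} = ∑ i with p i = t, d i) ∧ P g} * K := by
  obtain ⟨f₀, hf₀⟩ := exists_fun_card_fiber_eq (α := α) d hd
  have hcomp : ∀ f : α → κ, (∀ i, #{x | f x = i} = d i) →
      ∀ t, #{x | p (f x) = t} = ∑ i with p i = t, d i := by
    intro f hf t
    rw [Finset.card_eq_sum_card_fiberwise (f := f) (t := {i | p i = t}) (by intro x; simp)]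
    refine Finset.sum_congr rfl fun i hi => ?_
    rw [← hf i, Finset.filter_filter]
    congr 1
    ext x
    simp only [Finset.mem_filter, Finset.mem_univ, true_and] at hi ⊢
    exact ⟨fun h => h.2, fun h => ⟨h ▸ hi, h⟩⟩
  refine ⟨#{f : α → κ | (∀ i, #{x | f x = i} = d i) ∧ p ∘ f = p ∘ f₀},
    Finset.card_pos.mpr ⟨f₀, by simp [hf₀]⟩, fun P _ => ?_⟩
  rw [Finset.card_eq_sum_card_fiberwise (f := fun f : α → κ => p ∘ f)
      (t := {g : α → ι | (∀ t, #{x | g x = t} = ∑ i with p i = t, d i) ∧ P g}),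
    Finset.sum_const_nat]
  · intro g hg
    obtain ⟨hg, hP⟩ := (Finset.mem_filter.mp hg).2
    obtain ⟨σ, hσ⟩ := exists_perm_comp_eq_of_card_fiber_eq (f := p ∘ f₀) (g := g) fun t => by
      rw [hg, ← hcomp f₀ hf₀]; rfl
    refine Finset.card_equiv (σ.symm.arrowCongr (Equiv.refl κ)) fun f => ?_
    have h2 : σ.symm.arrowCongr (Equiv.refl κ) f = f ∘ σ := by ext; simp
    rw [h2]
    simp only [Finset.mem_filter, Finset.mem_univ, true_and, card_fiber_comp_perm, ← hσ]
    rw [← Function.comp_assoc, σ.surjective.injective_comp_right.eq_iff]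
    constructor
    · rintro ⟨⟨h, -⟩, h'⟩
      exact ⟨h, h'⟩
    · rintro ⟨h, rfl⟩
      exact ⟨⟨h, hP⟩, rfl⟩
  · intro f hf
    simp only [Finset.coe_filter, Finset.mem_univ, true_and, Set.mem_ofPred_eq] at hf ⊢
    exact ⟨hcomp f hf.1, hf.2⟩

end Counting

section Pairing

variable {m t : ℕ}

/-- The sequence of ordered edges obtained by pairing consecutive stubs. -/
def edgeSeqEquiv (m t : ℕ) : (Fin (2 * m) → Fin t) ≃ (Fin m → Fin t × Fin t) where
  toFun ψ e := (ψ ⟨2 * (e : ℕ), by have := e.isLt; omega⟩,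
    ψ ⟨2 * (e : ℕ) + 1, by have := e.isLt; omega⟩)
  invFun f l := if (l : ℕ) % 2 = 0 then (f ⟨l / 2, by have := l.isLt; omega⟩).1
    else (f ⟨l / 2, by have := l.isLt; omega⟩).2
  left_inv ψ := by
    ext l
    dsimp only
    split_ifs with h <;> congr 3 <;> omega
  right_inv f := by
    funext e
    have h1 : (2 * (e : ℕ) + 1) / 2 = e := by omega
    simp [h1, Nat.add_mod]

/-- The increasing rearrangement of an ordered pair. -/
def sortPair (p : Fin t × Fin t) : Fin t × Fin t := (min p.1 p.2, max p.1 p.2)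

lemma stubAdj_eq_mul_card (ψ : Fin (2 * m) → Fin t) (i j : Fin t) :
    stubAdj ψ i j = (if i = j then 2 else 1) *
      #{e | sortPair (edgeSeqEquiv m t ψ e) = sortPair (i, j)} := by
  rw [stubAdj, Finset.card_filter, Finset.mul_sum]
  refine Finset.sum_congr rfl fun e _ => ?_
  simp only [edgeSeqEquiv, sortPair, Equiv.coe_fn_mk, Prod.mk.injEq]
  generalize ψ ⟨2 * (e : ℕ), _⟩ = a
  generalize ψ ⟨2 * (e : ℕ) + 1, _⟩ = b
  grind

lemma stubAdj_comm (ψ : Fin (2 * m) → Fin t) (i j : Fin t) : stubAdj ψ i j = stubAdj ψ j i :=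
  Finset.sum_congr rfl fun _ _ => add_comm _ _

lemma sum_fin_two_mul (m : ℕ) (g : Fin (2 * m) → ℕ) :
    ∑ l, g l = ∑ e : Fin m, (g ⟨2 * (e : ℕ), by have := e.isLt; omega⟩ +
      g ⟨2 * (e : ℕ) + 1, by have := e.isLt; omega⟩) := by
  rw [← Equiv.sum_comp (finProdFinEquiv.trans (finCongr (Nat.mul_comm m 2))),
    Fintype.sum_prod_type]
  refine Finset.sum_congr rfl fun e _ => ?_
  rw [Fin.sum_univ_two]
  congr 2
  · ext; simp
  · ext; simp [add_comm]

lemma sum_stubAdj (ψ : Fin (2 * m) → Fin t) (i : Fin t) :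
    ∑ j, stubAdj ψ i j = colorCount ψ i := by
  simp only [colorCount, Finset.card_filter, sum_fin_two_mul, stubAdj]
  rw [Finset.sum_comm]
  refine Finset.sum_congr rfl fun e _ => ?_
  simp [Finset.sum_add_distrib, ite_and]

lemma sum_sum_eq_two_mul_sum_Astar (B : Fin t → Fin t → ℕ) (hsym : ∀ i j, B i j = B j i)
    (heven : ∀ i, 2 ∣ B i i) :
    ∑ i, ∑ j, B i j = 2 * ∑ i, ∑ j, if i ≤ j then Astar B i j else 0 := by
  rw [two_mul]
  nth_rewrite 2 [Finset.sum_comm]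
  simp only [← Finset.sum_add_distrib]
  refine Finset.sum_congr rfl fun i _ => Finset.sum_congr rfl fun j _ => ?_
  have := heven i
  have := hsym i j
  unfold Astar
  rcases lt_trichotomy i j with h | rfl | h
  · simp [h.le, h.not_ge, h.ne]
  · simp; omega
  · simp [h.le, h.not_ge, h.ne, this]

lemma forall_stubAdj_eq_iff (B : Fin t → Fin t → ℕ) (hsym : ∀ i j, B i j = B j i)
    (heven : ∀ i, 2 ∣ B i i) (ψ : Fin (2 * m) → Fin t) :
    (∀ i j, stubAdj ψ i j = B i j) ↔ ∀ p : Fin t × Fin t,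
      #{e | sortPair (edgeSeqEquiv m t ψ e) = p} =
        if p.1 ≤ p.2 then Astar B p.1 p.2 else 0 := by
  simp only [stubAdj_eq_mul_card]
  constructor
  · rintro h ⟨i, j⟩
    by_cases hij : i ≤ j
    · have h1 := h i j
      have h2 : sortPair (i, j) = (i, j) := by simp [sortPair, hij]
      rw [h2] at h1
      simp only [hij, if_true, Astar]
      split_ifs at h1 ⊢ with h3
      · subst h3
        omega
      · omega
    · simp only [hij, if_false, Finset.card_eq_zero, Finset.filter_eq_empty_iff]
      rintro e - he
      simp only [sortPair, Prod.mk.injEq] at he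
      exact hij (he.1 ▸ he.2 ▸ min_le_max)
  · intro h i j
    rw [h]
    have := heven i
    simp only [sortPair, min_le_max, if_true, Astar]
    rcases lt_trichotomy i j with h | rfl | h
    · simp [h.le, h.ne]
    · simp; omega
    · simp [h.le, h.ne, h.ne', hsym]

lemma card_sortPair_eq_pow (B : Fin t → Fin t → ℕ) (i j : Fin t) :
    #{q | sortPair q = (i, j)} ^ (if i ≤ j then Astar B i j else 0) =
      2 ^ (if i < j then B i j else 0) := by
  rcases lt_trichotomy i j with h | rfl | h
  · have h1 : ({q | sortPair q = (i, j)} : Finset (Fin t × Fin t)) = {(i, j), (j, i)} := by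
      ext ⟨a, b⟩
      simp only [sortPair, Finset.mem_filter, Finset.mem_univ, true_and, Finset.mem_insert,
        Finset.mem_singleton, Prod.mk.injEq]
      grind
    rw [h1, Finset.card_pair (by simp [h.ne])]
    simp [h, h.le, Astar, h.ne]
  · have h1 : ({q | sortPair q = (i, i)} : Finset (Fin t × Fin t)) = {(i, i)} := by
      ext ⟨a, b⟩
      simp only [sortPair, Finset.mem_filter, Finset.mem_univ, true_and,
        Finset.mem_singleton, Prod.mk.injEq]
      grind
    simp [h1]
  · simp [h.not_ge, h.not_gt]

/-- The number of urn configurations with a given adjacency matrix. -/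
lemma card_stubAdj_eq_mul_prod_factorial (B : Fin t → Fin t → ℕ) (hsym : ∀ i j, B i j = B j i)
    (heven : ∀ i, 2 ∣ B i i) (hsum : ∑ i, ∑ j, B i j = 2 * m) :
    #{ψ : Fin (2 * m) → Fin t | ∀ i j, stubAdj ψ i j = B i j} *
        ∏ i, ∏ j, (if i ≤ j then (Astar B i j)! else 1) =
      m ! * 2 ^ ∑ i, ∑ j, (if i < j then B i j else 0) := by
  have h := card_fun_card_fiber_comp_eq_mul_prod_factorial (α := Fin m) sortPair
    (fun p : Fin t × Fin t => if p.1 ≤ p.2 then Astar B p.1 p.2 else 0) (by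
      have := sum_sum_eq_two_mul_sum_Astar B hsym heven
      rw [Fintype.sum_prod_type, Fintype.card_fin]
      dsimp only
      omega)
  simp only [Fintype.prod_prod_type, Fintype.card_fin, card_sortPair_eq_pow,
    Finset.prod_pow_eq_pow_sum, Fintype.sum_prod_type] at h
  rw [← h]
  congr 1
  · exact Finset.card_equiv (edgeSeqEquiv m t) fun ψ => by
      simp only [Finset.mem_filter, Finset.mem_univ, true_and]
      exact forall_stubAdj_eq_iff B hsym heven ψ
  · refine Finset.prod_congr rfl fun i _ => Finset.prod_congr rfl fun j _ => ?_
    split_ifs <;> simp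

end Pairing

section Corner

variable {k m : ℕ}

/-- The matrix `A` bordered by the vector `r` and the corner entry `s`. -/
def borderedMatrix (A : Fin k → Fin k → ℕ) (r : Fin k → ℕ) (s : ℕ) :
    Fin (k + 1) → Fin (k + 1) → ℕ :=
  Fin.snoc (α := fun _ => Fin (k + 1) → ℕ) (fun i => Fin.snoc (α := fun _ => ℕ) (A i) (r i))
    (Fin.snoc (α := fun _ => ℕ) r s)

section borderedMatrix

variable (A : Fin k → Fin k → ℕ) (r : Fin k → ℕ) (s : ℕ) (i j : Fin k)

@[simp] lemma borderedMatrix_castSucc_castSucc :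
    borderedMatrix A r s i.castSucc j.castSucc = A i j := by simp [borderedMatrix]

@[simp] lemma borderedMatrix_castSucc_last :
    borderedMatrix A r s i.castSucc (Fin.last k) = r i := by simp [borderedMatrix]

@[simp] lemma borderedMatrix_last_castSucc :
    borderedMatrix A r s (Fin.last k) i.castSucc = r i := by simp [borderedMatrix]

@[simp] lemma borderedMatrix_last_last :
    borderedMatrix A r s (Fin.last k) (Fin.last k) = s := by simp [borderedMatrix]

end borderedMatrix

lemma sum_sub_degA_add {A : Fin k → Fin k → ℕ} {d : Fin k → ℕ} (hdeg : ∀ i, degA A i ≤ d i) :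
    ∑ i, (d i - degA A i) + ∑ i, ∑ j, A i j = ∑ i, d i := by
  rw [← Finset.sum_add_distrib]
  exact Finset.sum_congr rfl fun i _ => Nat.sub_add_cancel (hdeg i)

/-- Color counts and a corner of the adjacency matrix determine the lumped adjacency matrix. -/
lemma colorCount_and_corner_iff (A : Fin k → Fin k → ℕ) (b : ℕ)
    (hb : ∑ i, ∑ j, A i j = 2 * b) (d : Fin k → ℕ) (hdeg : ∀ i, degA A i ≤ d i)
    (hD : ∑ i, d i ≤ m) (ψ : Fin (2 * m) → Fin (k + 1)) :
    ((∀ t, colorCount ψ t = Fin.snoc (α := fun _ => ℕ) d (2 * m - ∑ i, d i) t) ∧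
        ∀ i j : Fin k, stubAdj ψ i.castSucc j.castSucc = A i j) ↔
      ∀ i j, stubAdj ψ i j =
        borderedMatrix A (fun i => d i - degA A i) (2 * (m - ∑ i, d i + b)) i j := by
  have hsum := sum_sub_degA_add hdeg
  simp only [Fin.forall_fin_succ', Fin.snoc_castSucc, Fin.snoc_last, ← sum_stubAdj,
    Fin.sum_univ_castSucc, borderedMatrix_castSucc_castSucc, borderedMatrix_castSucc_last,
    borderedMatrix_last_castSucc, borderedMatrix_last_last]
  constructor
  · rintro ⟨⟨h1, h2⟩, h3⟩
    have h4 : ∀ i : Fin k, stubAdj ψ i.castSucc (Fin.last k) = d i - degA A i := by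
      intro i
      have := h1 i
      simp only [h3] at this
      rw [degA]
      omega
    simp only [stubAdj_comm ψ (Fin.last k) (Fin.castSucc _), h4] at h2 ⊢
    refine ⟨fun i => ⟨h3 i, trivial⟩, fun _ => trivial, ?_⟩
    omega
  · rintro ⟨h1, h2, h3⟩
    refine ⟨⟨fun i => ?_, ?_⟩, fun i => (h1 i).1⟩
    · have := hdeg i
      simp only [(h1 i).1, (h1 i).2]
      rw [degA] at *
      omega
    · simp only [h2, h3]
      omega

lemma prod_factorial_borderedMatrix (A : Fin k → Fin k → ℕ) (r : Fin k → ℕ) (s : ℕ) :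
    ∏ i, ∏ j, (if i ≤ j then (Astar (borderedMatrix A r (2 * s)) i j)! else 1) =
      (∏ i, ∏ j, if i ≤ j then (Astar A i j)! else 1) * (∏ i, (r i)!) * s ! := by
  have h1 : ∀ i : Fin k, ¬ Fin.last k ≤ i.castSucc := fun i =>
    not_le.mpr (Fin.castSucc_lt_last i)
  have h2 : ∀ i j : Fin k, Astar (borderedMatrix A r (2 * s)) i.castSucc j.castSucc =
      Astar A i j := fun i j => by simp [Astar]
  have h3 : ∀ i : Fin k, Astar (borderedMatrix A r (2 * s)) i.castSucc (Fin.last k) = r i :=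
    fun i => by simp [Astar, (Fin.castSucc_lt_last i).ne]
  have h4 : Astar (borderedMatrix A r (2 * s)) (Fin.last k) (Fin.last k) = s := by simp [Astar]
  simp only [Fin.prod_univ_castSucc, h1, h2, h3, h4, Fin.castSucc_le_castSucc_iff, if_false,
    Fin.le_last, if_true, Finset.prod_const_one, mul_one, Finset.prod_mul_distrib, mul_assoc]

lemma sum_lt_borderedMatrix (A : Fin k → Fin k → ℕ) (r : Fin k → ℕ) (s : ℕ) :
    ∑ i, ∑ j, (if i < j then borderedMatrix A r s i j else 0) =
      (∑ i, ∑ j, if i < j then A i j else 0) + ∑ i, r i := by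
  have h1 : ∀ i : Fin (k + 1), ¬ Fin.last k < i := fun i => not_lt.mpr (Fin.le_last i)
  simp [Fin.sum_univ_castSucc, h1, Fin.castSucc_lt_last, Finset.sum_add_distrib]

lemma card_colorCount_mul (d : Fin k → ℕ) (hD : ∑ i, d i ≤ m) :
    #{ψ : Fin (2 * m) → Fin (k + 1) |
        ∀ t, colorCount ψ t = Fin.snoc (α := fun _ => ℕ) d (2 * m - ∑ i, d i) t} *
      ((∏ i, (d i)!) * (2 * m - ∑ i, d i)!) = (2 * m)! := by
  have h := card_fun_card_fiber_eq_mul_prod_factorial (α := Fin (2 * m))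
    (Fin.snoc (α := fun _ => ℕ) d (2 * m - ∑ i, d i)) (by
      simp only [Fin.sum_univ_castSucc, Fin.snoc_castSucc, Fin.snoc_last, Fintype.card_fin]
      omega)
  simp only [Fin.prod_univ_castSucc, Fin.snoc_castSucc, Fin.snoc_last, Fintype.card_fin] at h
  convert h
  rfl

lemma card_corner_mul (A : Fin k → Fin k → ℕ) (hsym : ∀ i j, A i j = A j i)
    (heven : ∀ i, 2 ∣ A i i) (b : ℕ) (hb : ∑ i, ∑ j, A i j = 2 * b) (d : Fin k → ℕ)
    (hdeg : ∀ i, degA A i ≤ d i) (hD : ∑ i, d i ≤ m) :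
    #{ψ : Fin (2 * m) → Fin (k + 1) |
        (∀ t, colorCount ψ t = Fin.snoc (α := fun _ => ℕ) d (2 * m - ∑ i, d i) t) ∧
        ∀ i j : Fin k, stubAdj ψ i.castSucc j.castSucc = A i j} *
      ((∏ i, ∏ j, if i ≤ j then (Astar A i j)! else 1) * (∏ i, (d i - degA A i)!) *
        (m - (∑ i, d i - b))!) =
      m ! * 2 ^ ((∑ i, ∑ j, if i < j then A i j else 0) + (∑ i, d i - 2 * b)) := by
  have hsum := sum_sub_degA_add hdeg
  have h := card_stubAdj_eq_mul_prod_factorial (m := m)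
    (borderedMatrix A (fun i => d i - degA A i) (2 * (m - ∑ i, d i + b)))
    (by simp [Fin.forall_fin_succ', hsym])
    (by simpa [Fin.forall_fin_succ'] using heven)
    (by
      simp [Fin.sum_univ_castSucc, Finset.sum_add_distrib]
      omega)
  rw [prod_factorial_borderedMatrix, sum_lt_borderedMatrix] at h
  simp only [← colorCount_and_corner_iff A b hb d hdeg hD] at h
  rw [show m - (∑ i, d i - b) = m - ∑ i, d i + b by omega,
    show ∑ i, d i - 2 * b = ∑ i, (d i - degA A i) by omega]
  exact h

lemma card_corner_eq_zero_of_lt_degA (A : Fin k → Fin k → ℕ) (d : Fin k → ℕ) (s : ℕ)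
    (i : Fin k) (hi : d i < degA A i) :
    #{ψ : Fin (2 * m) → Fin (k + 1) |
        (∀ t, colorCount ψ t = Fin.snoc (α := fun _ => ℕ) d s t) ∧
        ∀ i j : Fin k, stubAdj ψ i.castSucc j.castSucc = A i j} = 0 := by
  rw [Finset.card_eq_zero, Finset.filter_eq_empty_iff]
  rintro ψ - ⟨h1, h2⟩
  have := h1 i.castSucc
  simp only [← sum_stubAdj, Fin.sum_univ_castSucc, h2, Fin.snoc_castSucc] at this
  rw [degA] at hi
  omega

/-- The exact law of the corner, in the lumped configuration model. -/
lemma card_corner_mul_eq_card_colorCount_mul (A : Fin k → Fin k → ℕ)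
    (hsym : ∀ i j, A i j = A j i) (heven : ∀ i, 2 ∣ A i i) (b : ℕ)
    (hb : ∑ i, ∑ j, A i j = 2 * b) (d : Fin k → ℕ) (hD : ∑ i, d i ≤ m) :
    #{ψ : Fin (2 * m) → Fin (k + 1) |
        (∀ t, colorCount ψ t = Fin.snoc (α := fun _ => ℕ) d (2 * m - ∑ i, d i) t) ∧
        ∀ i j : Fin k, stubAdj ψ i.castSucc j.castSucc = A i j} *
      ((∏ i, ∏ j, if i ≤ j then (Astar A i j)! else 1) * (2 * m).descFactorial (∑ i, d i)) =
    #{ψ : Fin (2 * m) → Fin (k + 1) |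
        ∀ t, colorCount ψ t = Fin.snoc (α := fun _ => ℕ) d (2 * m - ∑ i, d i) t} *
      ((∏ i, (d i).descFactorial (degA A i)) * m.descFactorial (∑ i, d i - b) *
        2 ^ ((∑ i, ∑ j, if i < j then A i j else 0) + (∑ i, d i - 2 * b))) := by
  by_cases hdeg : ∀ i, degA A i ≤ d i
  · have h1 := card_corner_mul A hsym heven b hb d hdeg hD
    have h2 := card_colorCount_mul d hD
    have h3 : ∏ i, (d i)! = (∏ i, (d i - degA A i)!) * ∏ i, (d i).descFactorial (degA A i) := by
      rw [← Finset.prod_mul_distrib]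
      exact Finset.prod_congr rfl fun i _ => (Nat.factorial_mul_descFactorial (hdeg i)).symm
    have h4 := Nat.factorial_mul_descFactorial (show ∑ i, d i - b ≤ m by omega)
    have h5 := Nat.factorial_mul_descFactorial (show ∑ i, d i ≤ 2 * m by omega)
    rw [← h5, h3] at h2
    rw [← h4] at h1
    have hpos : 0 < (∏ i, (d i - degA A i)!) * (m - (∑ i, d i - b))! * (2 * m - ∑ i, d i)! := by
      positivity
    refine Nat.eq_of_mul_eq_mul_right hpos ?_
    linear_combination (2 * m - ∑ i, d i)! * (2 * m).descFactorial (∑ i, d i) * h1 -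
      (m - (∑ i, d i - b))! * m.descFactorial (∑ i, d i - b) *
        2 ^ ((∑ i, ∑ j, if i < j then A i j else 0) + (∑ i, d i - 2 * b)) * h2
  · push Not at hdeg
    obtain ⟨i, hi⟩ := hdeg
    rw [card_corner_eq_zero_of_lt_degA A d _ i hi,
      Finset.prod_eq_zero (f := fun i => (d i).descFactorial (degA A i)) (Finset.mem_univ i)
        (Nat.descFactorial_eq_zero_iff_lt.mpr hi)]
    simp

end Corner

section Lumping

variable {k m n : ℕ}

/-- The map collapsing all vertices outside the first `k` to one vertex. -/
def lump (k : ℕ) {n : ℕ} (x : Fin n) : Fin (k + 1) :=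
  if h : (x : ℕ) < k then Fin.castSucc ⟨x, h⟩ else Fin.last k

lemma lump_eq_castSucc_iff (hkn : k ≤ n) (x : Fin n) (i : Fin k) :
    lump k x = i.castSucc ↔ x = Fin.castLE hkn i := by
  unfold lump
  split_ifs with h
  · simp [Fin.ext_iff]
  · simp only [(Fin.castSucc_lt_last i).ne', Fin.ext_iff, Fin.val_castLE, false_iff]
    omega

lemma stubAdj_lump_comp (hkn : k ≤ n) (ψ : Fin (2 * m) → Fin n) (i j : Fin k) :
    stubAdj (lump k ∘ ψ) i.castSucc j.castSucc =
      stubAdj ψ (Fin.castLE hkn i) (Fin.castLE hkn j) := by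
  simp only [stubAdj, Function.comp_apply, lump_eq_castSucc_iff hkn]

lemma sum_lump_fiber (hkn : k ≤ n) (d : Fin n → ℕ) (hd : 2 * m = ∑ i, d i) (t : Fin (k + 1)) :
    ∑ x with lump k x = t, d x = Fin.snoc (α := fun _ => ℕ) (fun i => d (Fin.castLE hkn i))
      (2 * m - ∑ i, d (Fin.castLE hkn i)) t := by
  have h1 : ∀ i : Fin k, ∑ x with lump k x = i.castSucc, d x = d (Fin.castLE hkn i) := by
    intro i
    simp [lump_eq_castSucc_iff hkn, Finset.sum_filter]
  have h2 : ∑ t, ∑ x with lump k x = t, d x = 2 * m := by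
    rw [hd, Finset.sum_fiberwise]
  rw [Fin.sum_univ_castSucc] at h2
  simp only [h1] at h2
  refine Fin.lastCases ?_ (fun i => ?_) t
  · rw [Fin.snoc_last]
    omega
  · rw [Fin.snoc_castSucc, h1]

lemma exists_card_colorCount_eq_mul (hkn : k ≤ n) (d : Fin n → ℕ) (hd : 2 * m = ∑ i, d i) :
    ∃ K : ℕ, 0 < K ∧ ∀ (P : (Fin (2 * m) → Fin (k + 1)) → Prop) [DecidablePred P],
      #{ψ : Fin (2 * m) → Fin n | (∀ i, colorCount ψ i = d i) ∧ P (lump k ∘ ψ)} =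
        #{g : Fin (2 * m) → Fin (k + 1) | (∀ t, colorCount g t =
          Fin.snoc (α := fun _ => ℕ) (fun i => d (Fin.castLE hkn i))
            (2 * m - ∑ i, d (Fin.castLE hkn i)) t) ∧ P g} * K := by
  obtain ⟨K, hK, h⟩ := exists_card_lift_eq_mul (α := Fin (2 * m)) (lump k) d (by simp [hd])
  refine ⟨K, hK, fun P _ => ?_⟩
  simp only [← sum_lump_fiber hkn d hd]
  convert h P <;> rfl

/-- The exact law of the corner of the configuration model. -/
lemma card_corner_div_card (A : Fin k → Fin k → ℕ)
    (hsym : ∀ i j, A i j = A j i) (heven : ∀ i, 2 ∣ A i i) (b : ℕ)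
    (hb : ∑ i, ∑ j, A i j = 2 * b) (hkn : k ≤ n) (d : Fin n → ℕ) (hd : 2 * m = ∑ i, d i)
    (hD : ∑ i, d (Fin.castLE hkn i) ≤ m) :
    (#{ψ : Fin (2 * m) → Fin n | (∀ i, colorCount ψ i = d i) ∧
        ∀ i j : Fin k, stubAdj ψ (Fin.castLE hkn i) (Fin.castLE hkn j) = A i j} : ℝ) /
      (#{ψ : Fin (2 * m) → Fin n | ∀ i, colorCount ψ i = d i} : ℝ) =
    (∏ i, ∏ j, if i ≤ j then ((Astar A i j)! : ℝ)⁻¹ else 1) *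
      (∏ i, ((d (Fin.castLE hkn i)).descFactorial (degA A i) : ℝ)) *
      (m.descFactorial (∑ i, d (Fin.castLE hkn i) - b) *
        2 ^ ((∑ i, ∑ j, if i < j then A i j else 0) + (∑ i, d (Fin.castLE hkn i) - 2 * b)) /
        (2 * m).descFactorial (∑ i, d (Fin.castLE hkn i))) := by
  obtain ⟨K, hK, hlift⟩ := exists_card_colorCount_eq_mul hkn d hd
  have h1 := hlift fun g => ∀ i j : Fin k, stubAdj g i.castSucc j.castSucc = A i j
  have h2 := hlift fun _ => True
  simp only [stubAdj_lump_comp hkn, and_true] at h1 h2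
  have h3 := card_corner_mul_eq_card_colorCount_mul A hsym heven b hb
    (fun i => d (Fin.castLE hkn i)) hD
  have h4 := card_colorCount_mul (fun i => d (Fin.castLE hkn i)) hD
  have hN : (_ : ℝ) ≠ 0 :=
    Nat.cast_ne_zero.mpr (left_ne_zero_of_mul (h4.trans_ne (Nat.factorial_ne_zero _)))
  have hK' : (K : ℝ) ≠ 0 := by exact_mod_cast hK.ne'
  have hdesc : ((2 * m).descFactorial (∑ i, d (Fin.castLE hkn i)) : ℝ) ≠ 0 := by
    rw [Nat.cast_ne_zero, ne_eq, Nat.descFactorial_eq_zero_iff_lt]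
    omega
  have h5 : (∏ i, ∏ j, if i ≤ j then ((Astar A i j)! : ℝ)⁻¹ else 1) =
      ((∏ i, ∏ j, if i ≤ j then (Astar A i j)! else 1 : ℕ) : ℝ)⁻¹ := by
    push_cast
    simp only [← Finset.prod_inv_distrib, apply_ite (fun x : ℝ => x⁻¹), inv_one]
  have h6 : ((∏ i, ∏ j, if i ≤ j then (Astar A i j)! else 1 : ℕ) : ℝ) ≠ 0 := by
    rw [Nat.cast_ne_zero]
    refine Finset.prod_ne_zero_iff.mpr fun i _ => Finset.prod_ne_zero_iff.mpr fun j _ => ?_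
    split_ifs
    · exact Nat.factorial_ne_zero _
    · exact one_ne_zero
  rw [h5]
  have h7 := congrArg (Nat.cast (R := ℝ)) h3
  generalize (∏ i, ∏ j, if i ≤ j then (Astar A i j)! else 1 : ℕ) = F at h6 h7 ⊢
  rw [h1, h2, Nat.cast_mul, Nat.cast_mul, mul_div_mul_right _ _ hK', div_eq_iff hN]
  push_cast at h7
  field_simp
  linear_combination h7

end Lumping

section Analysis

lemma abs_prod_le_pow_card {ι : Type*} (s : Finset ι) (f : ι → ℝ) {B : ℝ}
    (hf : ∀ i ∈ s, |f i| ≤ B) : |∏ i ∈ s, f i| ≤ B ^ #s := by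
  rw [Finset.abs_prod, ← Finset.prod_const]
  exact Finset.prod_le_prod (fun i _ => abs_nonneg _) hf

lemma abs_prod_sub_prod_le {ι : Type*} (s : Finset ι) (f g : ι → ℝ) {B η : ℝ} (hB : 1 ≤ B)
    (hη : 0 ≤ η) (hf : ∀ i ∈ s, |f i| ≤ B) (hg : ∀ i ∈ s, |g i| ≤ B)
    (hfg : ∀ i ∈ s, |f i - g i| ≤ η) :
    |∏ i ∈ s, f i - ∏ i ∈ s, g i| ≤ #s * B ^ #s * η := by
  classical
  induction s using Finset.induction_on with
  | empty => simp
  | insert a s ha ih =>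
    simp only [Finset.forall_mem_insert] at hf hg hfg
    rw [Finset.prod_insert ha, Finset.prod_insert ha, Finset.card_insert_of_notMem ha,
      show f a * ∏ i ∈ s, f i - g a * ∏ i ∈ s, g i =
        f a * (∏ i ∈ s, f i - ∏ i ∈ s, g i) + (f a - g a) * ∏ i ∈ s, g i by ring]
    have hpow : 1 ≤ B ^ #s := one_le_pow₀ hB
    calc |f a * (∏ i ∈ s, f i - ∏ i ∈ s, g i) + (f a - g a) * ∏ i ∈ s, g i|
        ≤ B * (#s * B ^ #s * η) + η * B ^ #s := by
          refine (abs_add_le _ _).trans ?_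
          rw [abs_mul, abs_mul]
          gcongr
          · exact hf.1
          · exact ih hf.2 hg.2 hfg.2
          · exact hfg.1
          · exact abs_prod_le_pow_card s g hg.2
      _ ≤ B * (#s * B ^ #s * η) + B * (η * B ^ #s) := by
          exact add_le_add le_rfl (le_mul_of_one_le_left (mul_nonneg hη (by linarith)) hB)
      _ = _ := by push_cast; ring

lemma cast_descFactorial_eq_pow_mul_prod {N r : ℕ} (hN : 0 < N) (hr : r ≤ N) :
    (N.descFactorial r : ℝ) = (N : ℝ) ^ r * ∏ l ∈ Finset.range r, (1 - (l : ℝ) / N) := by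
  rw [Nat.descFactorial_eq_prod_range, Nat.cast_prod, ← Finset.card_range r,
    ← Finset.prod_const, Finset.card_range, ← Finset.prod_mul_distrib]
  refine Finset.prod_congr rfl fun l hl => ?_
  rw [Nat.cast_sub (by have := Finset.mem_range.mp hl; omega)]
  field_simp

lemma one_sub_div_pos {M : ℝ} {r l : ℕ} (hM : 0 < M) (hr : 2 * (r : ℝ) ≤ M) (hl : l < r) :
    0 < 1 - (l : ℝ) / M := by
  have : (l : ℝ) < r := by exact_mod_cast hl
  rw [sub_pos, div_lt_one hM]
  linarith [(Nat.cast_nonneg l : (0 : ℝ) ≤ l)]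

lemma prod_one_sub_div_pos {M : ℝ} {r : ℕ} (hM : 0 < M) (hr : 2 * (r : ℝ) ≤ M) :
    0 < ∏ l ∈ Finset.range r, (1 - (l : ℝ) / M) :=
  Finset.prod_pos fun _ hl => one_sub_div_pos hM hr (Finset.mem_range.mp hl)

lemma abs_log_one_sub_add_le {x : ℝ} (hx : 0 ≤ x) (hx' : 2 * x ≤ 1) :
    |Real.log (1 - x) + x| ≤ 2 * x ^ 2 := by
  have h := Real.abs_log_sub_add_sum_range_le (x := x) (by rw [abs_of_nonneg hx]; linarith) 1
  simp only [Finset.sum_range_one, zero_add, pow_one, Nat.cast_zero, div_one,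
    abs_of_nonneg hx, one_add_one_eq_two] at h
  rw [add_comm]
  refine h.trans ?_
  rw [div_le_iff₀ (by linarith)]
  nlinarith [sq_nonneg x]

lemma abs_log_prod_one_sub_div_add_le {M : ℝ} {r : ℕ} (hM : 0 < M) (hr : 2 * (r : ℝ) ≤ M) :
    |Real.log (∏ l ∈ Finset.range r, (1 - (l : ℝ) / M)) + r * (r - 1) / (2 * M)| ≤
      2 * r ^ 3 / M ^ 2 := by
  rw [Real.log_prod fun l hl => (one_sub_div_pos hM hr (Finset.mem_range.mp hl)).ne']
  have h1 : (r : ℝ) * (r - 1) / (2 * M) = ∑ l ∈ Finset.range r, (l : ℝ) / M := by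
    rw [← Finset.sum_div]
    have h2 : (∑ l ∈ Finset.range r, (l : ℝ)) = r * (r - 1) / 2 := by
      clear hr
      induction r with
      | zero => simp
      | succ r ih => rw [Finset.sum_range_succ, ih]; push_cast; ring
    rw [h2]
    field_simp
  rw [h1, ← Finset.sum_add_distrib]
  refine (Finset.abs_sum_le_sum_abs _ _).trans ?_
  calc ∑ l ∈ Finset.range r, |Real.log (1 - (l : ℝ) / M) + l / M|
      ≤ ∑ l ∈ Finset.range r, 2 * ((r : ℝ) / M) ^ 2 := by
        refine Finset.sum_le_sum fun l hl => ?_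
        have hl' : (l : ℝ) ≤ r := by exact_mod_cast (Finset.mem_range.mp hl).le
        refine (abs_log_one_sub_add_le (by positivity) ?_).trans (by gcongr)
        rw [← mul_div_assoc, div_le_one hM]
        linarith
    _ = _ := by
        rw [Finset.sum_const, Finset.card_range, nsmul_eq_mul]
        field_simp

/-- The ratio of falling factorials governing the corner probability is close to a Gaussian. -/
lemma abs_prod_div_prod_sub_exp_le {b D m : ℕ} (hm : 0 < m) (hb : b ≤ D) (hD : 2 * D ≤ m)
    (hsmall : 3 * (D : ℝ) ^ 3 / m ^ 2 + (6 * b + 3) * D / m ≤ 1) :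
    |(∏ l ∈ Finset.range (D - b), (1 - (l : ℝ) / m)) /
        (∏ l ∈ Finset.range D, (1 - (l : ℝ) / (2 * m))) - Real.exp (-(D : ℝ) ^ 2 / (4 * m))| ≤
      2 * (3 * (D : ℝ) ^ 3 / m ^ 2 + (6 * b + 3) * D / m) := by
  have hm' : (0 : ℝ) < m := by exact_mod_cast hm
  have hD' : 2 * (D : ℝ) ≤ m := by exact_mod_cast hD
  have hb' : (b : ℝ) ≤ D := by exact_mod_cast hb
  have hb0 : (0 : ℝ) ≤ b := Nat.cast_nonneg b
  have hDb : ((D - b : ℕ) : ℝ) = D - b := Nat.cast_sub hb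
  have hr1 : 2 * ((D - b : ℕ) : ℝ) ≤ m := by rw [hDb]; linarith
  have hr2 : 2 * (D : ℝ) ≤ 2 * m := by linarith
  have hp1 := prod_one_sub_div_pos hm' hr1
  have hp2 := prod_one_sub_div_pos (by positivity) hr2
  have hl1 := abs_log_prod_one_sub_div_add_le hm' hr1
  have hl2 := abs_log_prod_one_sub_div_add_le (by positivity) hr2
  rw [← Real.exp_log (div_pos hp1 hp2), Real.log_div hp1.ne' hp2.ne']
  generalize Real.log (∏ l ∈ Finset.range (D - b), (1 - (l : ℝ) / m)) = u at hl1 ⊢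
  generalize Real.log (∏ l ∈ Finset.range D, (1 - (l : ℝ) / (2 * m))) = w at hl2 ⊢
  rw [hDb] at hl1
  have hcube : 2 * ((D : ℝ) - b) ^ 3 / m ^ 2 ≤ 2 * (D : ℝ) ^ 3 / m ^ 2 := by
    gcongr
    all_goals linarith
  have hq : |((4 * b + 1) * (D : ℝ) - 2 * b * (b + 1)) / (4 * m)| ≤ (6 * b + 3) * D / m := by
    rw [abs_div, abs_of_pos (by positivity : (0 : ℝ) < 4 * m), div_le_div_iff₀ (by positivity) hm']
    have : |(4 * b + 1) * (D : ℝ) - 2 * b * (b + 1)| ≤ (6 * b + 3) * D := by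
      rw [abs_le]
      constructor <;> nlinarith [mul_nonneg hb0 (hb0.trans hb'), mul_le_mul_of_nonneg_left hb' hb0]
    nlinarith [mul_nonneg (mul_nonneg (by positivity : (0 : ℝ) ≤ 6 * b + 3) (hb0.trans hb')) hm'.le]
  have hkey : |u - w - -(D : ℝ) ^ 2 / (4 * m)| ≤ 3 * (D : ℝ) ^ 3 / m ^ 2 + (6 * b + 3) * D / m := by
    have h1 : u - w - -(D : ℝ) ^ 2 / (4 * m) =
        (u + ((D : ℝ) - b) * (D - b - 1) / (2 * m)) - (w + (D : ℝ) * (D - 1) / (2 * (2 * m))) +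
          ((4 * b + 1) * (D : ℝ) - 2 * b * (b + 1)) / (4 * m) := by
      field_simp
      ring
    have h2 : 2 * (D : ℝ) ^ 3 / (2 * m) ^ 2 ≤ (D : ℝ) ^ 3 / m ^ 2 := by
      rw [div_le_div_iff₀ (by positivity) (by positivity)]
      nlinarith [(by positivity : (0 : ℝ) ≤ (D : ℝ) ^ 3 * m ^ 2)]
    rw [h1]
    refine (abs_add_le _ _).trans (add_le_add ((abs_sub _ _).trans ?_) hq)
    calc _ ≤ 2 * (D : ℝ) ^ 3 / m ^ 2 + (D : ℝ) ^ 3 / m ^ 2 :=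
          add_le_add (hl1.trans hcube) (hl2.trans h2)
      _ = _ := by ring
  have hexp : Real.exp (-(D : ℝ) ^ 2 / (4 * m)) ≤ 1 := by
    rw [Real.exp_le_one_iff, neg_div]
    exact neg_nonpos.mpr (by positivity)
  rw [show Real.exp (u - w) - Real.exp (-(D : ℝ) ^ 2 / (4 * m)) =
      Real.exp (-(D : ℝ) ^ 2 / (4 * m)) * (Real.exp (u - w - -(D : ℝ) ^ 2 / (4 * m)) - 1) by
    rw [mul_sub, ← Real.exp_add]; ring_nf, abs_mul, abs_of_pos (Real.exp_pos _)]
  calc _ ≤ 1 * (2 * |u - w - -(D : ℝ) ^ 2 / (4 * m)|) := by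
        gcongr
        exact Real.abs_exp_sub_one_le (hkey.trans hsmall)
    _ ≤ _ := by linarith

end Analysis

section Limit

lemma descFactorial_ratio_eq {b D m p h : ℕ} (hm : 0 < m) (hb : 2 * b ≤ D) (hD : D ≤ m)
    (hph : p + h = b) :
    ((m.descFactorial (D - b) : ℝ) * 2 ^ (p + (D - 2 * b)) / (2 * m).descFactorial D) =
      ((2 * m : ℝ) ^ b)⁻¹ * ((2 : ℝ) ^ h)⁻¹ *
        ((∏ l ∈ Finset.range (D - b), (1 - (l : ℝ) / m)) /
          ∏ l ∈ Finset.range D, (1 - (l : ℝ) / (2 * m))) := by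
  have hm' : (m : ℝ) ≠ 0 := by exact_mod_cast hm.ne'
  have h1 := cast_descFactorial_eq_pow_mul_prod hm (show D - b ≤ m by omega)
  have h2 := cast_descFactorial_eq_pow_mul_prod (show 0 < 2 * m by omega)
    (show D ≤ 2 * m by omega)
  push_cast at h2
  rw [h1, h2]
  have h3 : (m : ℝ) ^ (D - b) * 2 ^ (p + (D - 2 * b)) =
      ((2 * m : ℝ) ^ b)⁻¹ * ((2 : ℝ) ^ h)⁻¹ * (2 * m) ^ D := by
    rw [eq_comm, ← mul_inv, inv_mul_eq_iff_eq_mul₀ (by positivity), mul_pow, mul_pow]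
    calc (2 : ℝ) ^ D * m ^ D = 2 ^ (b + h + (p + (D - 2 * b))) * m ^ (b + (D - b)) := by
          congr 2 <;> omega
      _ = _ := by rw [pow_add, pow_add, pow_add (m : ℝ)]; ring
  calc _ = (m : ℝ) ^ (D - b) * 2 ^ (p + (D - 2 * b)) / (2 * m) ^ D *
        ((∏ l ∈ Finset.range (D - b), (1 - (l : ℝ) / m)) /
          ∏ l ∈ Finset.range D, (1 - (l : ℝ) / (2 * m))) := by
        rw [_root_.div_mul_div_comm]; ring
    _ = _ := by rw [h3, mul_div_cancel_right₀ _ (by positivity)]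

/-- Rescaled products of falling factorials are close to products of powers. -/
lemma abs_prod_descFactorial_div_sub_le {ι : Type*} [Fintype ι] (a d : ι → ℕ) {n : ℕ} {B : ℝ}
    (hn : 0 < n) (hB : 1 ≤ B) (hd : ∀ i, (d i : ℝ) / n ≤ B) :
    |∏ i, ((d i).descFactorial (a i) : ℝ) / (n : ℝ) ^ a i| ≤ B ^ ∑ i, a i ∧
    |∏ i, ((d i).descFactorial (a i) : ℝ) / (n : ℝ) ^ a i - ∏ i, ((d i : ℝ) / n) ^ a i| ≤
      (∑ i, a i : ℕ) * B ^ (∑ i, a i) * ((∑ i, a i : ℕ) / n) := by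
  have hn' : (0 : ℝ) < n := by exact_mod_cast hn
  have h1 : ∏ i, ((d i).descFactorial (a i) : ℝ) / (n : ℝ) ^ a i =
      ∏ x ∈ Finset.univ.sigma fun i => Finset.range (a i), ((d x.1 - x.2 : ℕ) : ℝ) / n := by
    rw [Finset.prod_sigma]
    refine Finset.prod_congr rfl fun i _ => ?_
    rw [Nat.descFactorial_eq_prod_range, Nat.cast_prod, Finset.prod_div_distrib,
      Finset.prod_const, Finset.card_range]
  have h2 : ∏ i, ((d i : ℝ) / n) ^ a i =
      ∏ x ∈ Finset.univ.sigma fun i => Finset.range (a i), (d x.1 : ℝ) / n := by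
    rw [Finset.prod_sigma]
    exact Finset.prod_congr rfl fun i _ => by simp [div_pow]
  have hcard : #(Finset.univ.sigma fun i => Finset.range (a i)) = ∑ i, a i := by simp
  have h3 : ∀ i l : ℕ, (i - l : ℕ) ≤ (i : ℝ) := fun i l => by exact_mod_cast Nat.sub_le i l
  have hf : ∀ x ∈ Finset.univ.sigma fun i => Finset.range (a i),
      |((d x.1 - x.2 : ℕ) : ℝ) / n| ≤ B := fun x _ => by
    rw [abs_of_nonneg (by positivity)]
    exact le_trans (by gcongr; exact Nat.sub_le _ _) (hd x.1)
  rw [h1, h2, ← hcard]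
  refine ⟨abs_prod_le_pow_card _ _ hf, abs_prod_sub_prod_le _ _ _ hB (by positivity) hf ?_ ?_⟩
  · intro x _
    rw [abs_of_nonneg (by positivity)]
    exact hd x.1
  · rintro ⟨i, l⟩ hx
    simp only [Finset.mem_sigma, Finset.mem_univ, true_and, Finset.mem_range] at hx
    have hl : (l : ℝ) ≤ (∑ i, a i : ℕ) := by
      exact_mod_cast hx.le.trans (Finset.single_le_sum (fun _ _ => Nat.zero_le _)
        (Finset.mem_univ i))
    have h4 : (d i : ℝ) ≤ (d i - l : ℕ) + l := by
      exact_mod_cast (by omega : d i ≤ d i - l + l)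
    rw [hcard, ← sub_div, abs_div, abs_of_pos hn', abs_of_nonpos (by linarith [h3 (d i) l])]
    gcongr
    linarith

lemma cubic_error_le {ε K D m n : ℝ} {b : ℕ} (hε : 0 < ε) (hn : 0 < n)
    (hD₀ : 0 ≤ D) (hD : D ≤ K * n) (hmn : ε * n ^ 2 / 2 ≤ m) :
    3 * D ^ 3 / m ^ 2 + (6 * b + 3) * D / m ≤
      (12 * K ^ 3 / ε ^ 2 + (12 * b + 6) * K / ε) / n := by
  calc 3 * D ^ 3 / m ^ 2 + (6 * b + 3) * D / m
      ≤ 3 * (K * n) ^ 3 / (ε * n ^ 2 / 2) ^ 2 + (6 * b + 3) * (K * n) / (ε * n ^ 2 / 2) := by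
        have := hD₀.trans hD
        gcongr
    _ = _ := by
        field_simp
        ring

lemma sum_lt_add_sum_diag_eq {k b : ℕ} (A : Fin k → Fin k → ℕ) (hsym : ∀ i j, A i j = A j i)
    (heven : ∀ i, 2 ∣ A i i) (hb : ∑ i, ∑ j, A i j = 2 * b) :
    (∑ i, ∑ j, if i < j then A i j else 0) + ∑ i, A i i / 2 = b := by
  have h1 : ∀ i j, (if i ≤ j then Astar A i j else 0) =
      (if i < j then A i j else 0) + if i = j then A i i / 2 else 0 := by
    intro i j
    unfold Astar
    rcases lt_trichotomy i j with h | rfl | h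
    · simp [h, h.le, h.ne]
    · simp
    · simp [h.not_ge, h.not_gt, h.ne']
  have h2 := sum_sum_eq_two_mul_sum_Astar A hsym heven
  simp only [h1, Finset.sum_add_distrib, Finset.sum_ite_eq, Finset.mem_univ, if_true] at h2
  omega

/-- The corner probability in the form of the Poisson main term, with the Gaussian factor
replaced by `R`. -/
lemma exists_card_corner_div_card_eq {k m n b : ℕ} (A : Fin k → Fin k → ℕ)
    (hsym : ∀ i j, A i j = A j i) (heven : ∀ i, 2 ∣ A i i) (hb : ∑ i, ∑ j, A i j = 2 * b)
    (hkn : k ≤ n) (hn : 0 < n) (d : Fin n → ℕ) (hd : 2 * m = ∑ i, d i) (hm : 0 < m)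
    (hD : 2 * ∑ i, d (Fin.castLE hkn i) ≤ m)
    (hsmall : 3 * ((∑ i, d (Fin.castLE hkn i) : ℕ) : ℝ) ^ 3 / m ^ 2 +
      (6 * b + 3) * (∑ i, d (Fin.castLE hkn i) : ℕ) / m ≤ 1) :
    ∃ R : ℝ, |R - Real.exp (-((∑ i, d (Fin.castLE hkn i) : ℕ) : ℝ) ^ 2 / (4 * m))| ≤
        2 * (3 * ((∑ i, d (Fin.castLE hkn i) : ℕ) : ℝ) ^ 3 / m ^ 2 +
          (6 * b + 3) * (∑ i, d (Fin.castLE hkn i) : ℕ) / m) ∧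
      (#{ψ : Fin (2 * m) → Fin n | (∀ i, colorCount ψ i = d i) ∧
          ∀ i j : Fin k, stubAdj ψ (Fin.castLE hkn i) (Fin.castLE hkn j) = A i j} : ℝ) /
        (#{ψ : Fin (2 * m) → Fin n | ∀ i, colorCount ψ i = d i} : ℝ) =
      R * (∏ i, ∏ j, if i ≤ j then ((Astar A i j)! : ℝ)⁻¹ else 1) *
        (∏ i, ((d (Fin.castLE hkn i)).descFactorial (degA A i) : ℝ) / (n : ℝ) ^ degA A i) *
        (((2 * m : ℝ) / (n : ℝ) ^ 2) ^ b)⁻¹ * ((2 : ℝ) ^ (∑ i, A i i / 2))⁻¹ := by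
  have hn' : (n : ℝ) ≠ 0 := by exact_mod_cast hn.ne'
  have hm' : (m : ℝ) ≠ 0 := by exact_mod_cast hm.ne'
  rw [card_corner_div_card A hsym heven b hb hkn d hd (by omega)]
  by_cases hbD : 2 * b ≤ ∑ i, d (Fin.castLE hkn i)
  · refine ⟨_, abs_prod_div_prod_sub_exp_le (b := b) hm (by omega) hD hsmall, ?_⟩
    rw [descFactorial_ratio_eq hm hbD (by omega) (sum_lt_add_sum_diag_eq A hsym heven hb),
      Finset.prod_div_distrib, Finset.prod_pow_eq_pow_sum,
      show ∑ i, degA A i = 2 * b from hb, div_pow, ← pow_mul, inv_div]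
    generalize (∏ l ∈ Finset.range _, (1 - (l : ℝ) / m)) /
      ∏ l ∈ Finset.range _, (1 - (l : ℝ) / (2 * m)) = R
    field_simp
  · obtain ⟨i, hi⟩ : ∃ i, d (Fin.castLE hkn i) < degA A i := by
      by_contra! h
      exact hbD (hb ▸ Finset.sum_le_sum fun i _ => h i)
    have h0 := Nat.descFactorial_eq_zero_iff_lt.mpr hi
    refine ⟨_, by rw [sub_self, abs_zero]; positivity, ?_⟩
    rw [Finset.prod_eq_zero (f := fun i =>
        ((d (Fin.castLE hkn i)).descFactorial (degA A i) : ℝ)) (Finset.mem_univ i) (by simp [h0]),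
      Finset.prod_eq_zero (f := fun i => ((d (Fin.castLE hkn i)).descFactorial (degA A i) : ℝ) /
        (n : ℝ) ^ degA A i) (Finset.mem_univ i) (by simp [h0])]
    simp

end Limit

/-- **Poisson approximation for the configuration model.**
Fix `ε > 0`, `k` and `A ∈ A_k`.  Let `X_n` be the configuration model on `n` vertices
with degree sequence `(d_i)`, `m = (1/2)∑ d_i` edges, `z_i = d_i/n`, `ρ_n = 2m/n²`.
If `ε ≤ ρ_n ≤ 1/ε` and `z_i ≤ 1/ε` for `i ∈ [k]`, then `P(X_n^{[k]} = A)` equals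
`exp(−(∑z_i)²/(2ρ_n)) · ∏_{i≤j}(1/A*(i,j)!) · ∏_i z_i^{d(A,i)} · ρ_n^{−m_{[k]}} ·
2^{−∑_i A*(i,i)}` up to an error tending to `0` as `n → ∞`, uniformly over all such
degree sequences.  Here the configuration model probability is realized as the fraction
of urn configurations with the given type vector whose stub-pairing has corner `A`. -/
theorem configuration_model_poisson_approximation
    (ε : ℝ) (hε : 0 < ε) (k : ℕ) (A : Fin k → Fin k → ℕ)
    (hsymA : ∀ i j, A i j = A j i) (hevenA : ∀ i, 2 ∣ A i i) :
    ∀ δ : ℝ, 0 < δ → ∃ N : ℕ, ∀ n, N ≤ n → ∀ hkn : k ≤ n,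
      ∀ (d : Fin n → ℕ) (m : ℕ), 2 * m = ∑ i, d i →
      ε ≤ (2 * m : ℝ) / (n : ℝ) ^ 2 → (2 * m : ℝ) / (n : ℝ) ^ 2 ≤ ε⁻¹ →
      (∀ i : Fin k, (d (Fin.castLE hkn i) : ℝ) / n ≤ ε⁻¹) →
      |(((Finset.univ.filter fun ψ : Fin (2 * m) → Fin n =>
              (∀ i, colorCount ψ i = d i) ∧
              ∀ i j : Fin k, stubAdj ψ (Fin.castLE hkn i) (Fin.castLE hkn j) = A i j).card
            : ℝ) /
          ((Finset.univ.filter fun ψ : Fin (2 * m) → Fin n =>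
              ∀ i, colorCount ψ i = d i).card : ℝ)) -
        (Real.exp (-(∑ i : Fin k, (d (Fin.castLE hkn i) : ℝ) / n) ^ 2 /
              (2 * ((2 * m : ℝ) / (n : ℝ) ^ 2))) *
          (∏ i : Fin k, ∏ j : Fin k,
            if i ≤ j then (((Astar A i j)! : ℝ))⁻¹ else 1) *
          (∏ i : Fin k, ((d (Fin.castLE hkn i) : ℝ) / n) ^ degA A i) *
          (((2 * m : ℝ) / (n : ℝ) ^ 2) ^ ((∑ i : Fin k, ∑ j : Fin k, A i j) / 2))⁻¹ *
          ((2 : ℝ) ^ (∑ i : Fin k, A i i / 2))⁻¹)| ≤ δ := by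
  intro δ hδ
  obtain ⟨b, hb⟩ : ∃ b, ∑ i, ∑ j, A i j = 2 * b :=
    ⟨_, sum_sum_eq_two_mul_sum_Astar A hsymA hevenA⟩
  rw [hb, Nat.mul_div_cancel_left b two_pos]
  set B : ℝ := max 1 ε⁻¹
  set K : ℝ := k * ε⁻¹
  set C : ℝ := ∏ i : Fin k, ∏ j : Fin k, if i ≤ j then (((Astar A i j)! : ℝ))⁻¹ else 1
  set c₁ : ℝ := 12 * K ^ 3 / ε ^ 2 + (12 * b + 6) * K / ε
  set c₂ : ℝ := C * (ε ^ b)⁻¹ * (2 * c₁ * B ^ (2 * b) + (2 * b : ℕ) * B ^ (2 * b) * (2 * b : ℕ))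
  have hB : 1 ≤ B := le_max_left _ _
  have hC : 0 ≤ C := Finset.prod_nonneg fun i _ => Finset.prod_nonneg fun j _ => by
    split_ifs <;> positivity
  have hK : 0 ≤ K := by positivity
  have hc₁ : 0 ≤ c₁ := by positivity
  have hc₂ : 0 ≤ c₂ := by positivity
  refine ⟨⌈4 * K / ε + c₁ + c₂ / δ⌉₊ + 1, fun n hNn hkn d m hd hρ _ hz => ?_⟩
  have hn : 0 < n := by omega
  have hn' : (0 : ℝ) < n := by exact_mod_cast hn
  have hceil : 4 * K / ε + c₁ + c₂ / δ ≤ n :=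
    (Nat.le_ceil _).trans (by exact_mod_cast (by omega : _ ≤ n))
  have hKε : 0 ≤ 4 * K / ε := by positivity
  have hc₂δ : 0 ≤ c₂ / δ := by positivity
  have hmn : ε * (n : ℝ) ^ 2 / 2 ≤ m := by
    rw [le_div_iff₀ (by positivity)] at hρ
    linarith
  have hm' : (0 : ℝ) < m := lt_of_lt_of_le (by positivity) hmn
  have hm : 0 < m := by exact_mod_cast hm'
  have hD : ((∑ i, d (Fin.castLE hkn i) : ℕ) : ℝ) ≤ K * n := by
    push_cast
    calc ∑ i, (d (Fin.castLE hkn i) : ℝ) ≤ ∑ _i : Fin k, ε⁻¹ * n :=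
          Finset.sum_le_sum fun i _ => (div_le_iff₀ hn').mp (hz i)
      _ = K * n := by simp [K, mul_assoc]
  have hDm : 2 * ∑ i, d (Fin.castLE hkn i) ≤ m := by
    have h1 : 4 * K ≤ n * ε := (div_le_iff₀ hε).mp (by linarith)
    have h2 : 2 * ((∑ i, d (Fin.castLE hkn i) : ℕ) : ℝ) ≤ m := by
      nlinarith [mul_le_mul_of_nonneg_right h1 hn'.le]
    exact_mod_cast h2
  have herr := cubic_error_le (b := b) hε hn' (Nat.cast_nonneg _) hD hmn
  obtain ⟨R, hR, hprob⟩ := exists_card_corner_div_card_eq A hsymA hevenA hb hkn hn d hd hm hDm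
    (herr.trans (by rw [div_le_one hn']; linarith))
  replace hR := hR.trans (mul_le_mul_of_nonneg_left herr zero_le_two)
  obtain ⟨hX, hXY⟩ := abs_prod_descFactorial_div_sub_le (degA A)
    (fun i => d (Fin.castLE hkn i)) hn hB fun i => (hz i).trans (le_max_right _ _)
  rw [show ∑ i, degA A i = 2 * b from hb] at hX hXY
  have hexp : -(∑ i : Fin k, (d (Fin.castLE hkn i) : ℝ) / n) ^ 2 /
      (2 * ((2 * m : ℝ) / (n : ℝ) ^ 2)) =
      -((∑ i, d (Fin.castLE hkn i) : ℕ) : ℝ) ^ 2 / (4 * m) := by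
    rw [← Finset.sum_div]
    push_cast
    field_simp
    ring
  have hG : Real.exp (-((∑ i, d (Fin.castLE hkn i) : ℕ) : ℝ) ^ 2 / (4 * m)) ≤ 1 := by
    rw [Real.exp_le_one_iff, neg_div]
    exact neg_nonpos.mpr (by positivity)
  rw [hprob, hexp]
  generalize (∏ i, ((d (Fin.castLE hkn i)).descFactorial (degA A i) : ℝ) / (n : ℝ) ^ degA A i) = X
    at hX hXY ⊢
  generalize (∏ i, ((d (Fin.castLE hkn i) : ℝ) / n) ^ degA A i) = Y at hXY ⊢
  have hG₀ := Real.exp_pos (-((∑ i, d (Fin.castLE hkn i) : ℕ) : ℝ) ^ 2 / (4 * m))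
  generalize Real.exp (-((∑ i, d (Fin.castLE hkn i) : ℕ) : ℝ) ^ 2 / (4 * m)) = G at hR hG hG₀ ⊢
  have hρinv : (((2 * m : ℝ) / (n : ℝ) ^ 2) ^ b)⁻¹ ≤ (ε ^ b)⁻¹ := by gcongr
  have htwo : ((2 : ℝ) ^ (∑ i : Fin k, A i i / 2))⁻¹ ≤ 1 :=
    inv_le_one_of_one_le₀ (one_le_pow₀ one_le_two)
  have hρ₀ : 0 ≤ (((2 * m : ℝ) / (n : ℝ) ^ 2) ^ b)⁻¹ := by positivity
  have htwo₀ : 0 ≤ ((2 : ℝ) ^ (∑ i : Fin k, A i i / 2))⁻¹ := by positivity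
  generalize (((2 * m : ℝ) / (n : ℝ) ^ 2) ^ b)⁻¹ = r at hρinv hρ₀ ⊢
  generalize ((2 : ℝ) ^ (∑ i : Fin k, A i i / 2))⁻¹ = s at htwo htwo₀ ⊢
  have hmain : |(R - G) * X + G * (X - Y)| ≤
      2 * (c₁ / n) * B ^ (2 * b) + 1 * ((2 * b : ℕ) * B ^ (2 * b) * ((2 * b : ℕ) / n)) := by
    refine (abs_add_le _ _).trans ?_
    rw [abs_mul, abs_mul, abs_of_pos hG₀]
    gcongr
  calc |R * C * X * r * s - G * C * Y * r * s|
      = C * r * s * |(R - G) * X + G * (X - Y)| := by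
        rw [show R * C * X * r * s - G * C * Y * r * s =
            (C * r * s) * ((R - G) * X + G * (X - Y)) by ring, abs_mul,
          abs_of_nonneg (by positivity : 0 ≤ C * r * s)]
    _ ≤ C * (ε ^ b)⁻¹ * 1 *
        (2 * (c₁ / n) * B ^ (2 * b) + 1 * ((2 * b : ℕ) * B ^ (2 * b) * ((2 * b : ℕ) / n))) := by
        gcongr
    _ = c₂ / n := by
        simp only [c₂]
        ring
    _ ≤ δ := by
        rw [div_le_iff₀ hn', ← div_le_iff₀' hδ]
        linarith
end
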